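/- arXiv:2601.19230 — 3 statements merged into one kernel-verified Lean document; each statement's English description precedes it below -/
import Mathlib

section
/- For all integers k ≥ 1, h ≥ 0 and c ≥ 3, the Dyck-grid D^{(h+1,c−2)}_{18k} contains the Dyck-grid D^{(h,c)}_k as a minor. -/
open SimpleGraph

/-- `H` is a minor of `G`: there is a minor model of `H` in `G`, i.e. a family of pairwise
disjoint connected branch sets, one for each vertex of `H`, such that every edge of `H` is
realised by an edge of `G` between the corresponding branch sets. -/
def IsMinorOf {α β : Type*} (H : SimpleGraph α) (G : SimpleGraph β) : Prop :=
  ∃ X : α → Set β,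
    (∀ u v : α, u ≠ v → Disjoint (X u) (X v)) ∧
    (∀ v : α, (G.induce (X v)).Connected) ∧
    (∀ u v : α, H.Adj u v → ∃ a ∈ X u, ∃ b ∈ X v, G.Adj a b)

/-- The mixed surface grid of order `k` built from the `(k, 4*n*k)`-cylindrical grid
(where `n = h + c + 1`), with a handle added at every position in `Ih` and a crosscap added
at every position in `Ic`.  The vertex `v_j^i` (for `i ∈ [k]`, `j ∈ ℤ/(4nk)`) is encoded as
`(⟨i - 1⟩, j)`, so the top row `v^1` corresponds to first coordinate `0`. -/
def mixedGrid (k n : ℕ) (Ih Ic : Finset ℕ) :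
    SimpleGraph (Fin k × ZMod (4 * n * k)) :=
  SimpleGraph.fromRel (fun p q =>
    (p.1 = q.1 ∧ q.2 = p.2 + 1) ∨
    (p.2 = q.2 ∧ (q.1 : ℕ) = (p.1 : ℕ) + 1) ∨
    ((p.1 : ℕ) = 0 ∧ (q.1 : ℕ) = 0 ∧ ∃ i ∈ Ih, ∃ j ∈ Finset.Icc 1 k,
      ((p.2 = ((4 * k * (i - 1) + j : ℕ) : ZMod (4 * n * k)) ∧
        q.2 = ((4 * k * (i - 1) + 3 * k - j + 1 : ℕ) : ZMod (4 * n * k))) ∨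
       (p.2 = ((4 * k * (i - 1) + k + j : ℕ) : ZMod (4 * n * k)) ∧
        q.2 = ((4 * k * (i - 1) + 4 * k - j + 1 : ℕ) : ZMod (4 * n * k))))) ∨
    ((p.1 : ℕ) = 0 ∧ (q.1 : ℕ) = 0 ∧ ∃ i ∈ Ic, ∃ j ∈ Finset.Icc 1 (2 * k),
      p.2 = ((4 * k * (i - 1) + j : ℕ) : ZMod (4 * n * k)) ∧
      q.2 = ((4 * k * (i - 1) + 2 * k + j : ℕ) : ZMod (4 * n * k))))

/-- The Dyck grid `D_k^{(h,c)}`. -/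
def dyckGrid (k h c : ℕ) : SimpleGraph (Fin k × ZMod (4 * (h + c + 1) * k)) :=
  mixedGrid k (h + c + 1) (Finset.Icc 2 (h + 1)) (Finset.Icc (h + 2) (h + c + 1))


namespace DyckTrade

/-- Column map inside a handle block. -/
def gH (k t : ℕ) : ℕ :=
  if t < k then t else if t < 2 * k then 17 * k + t else if t < 3 * k then 51 * k + t
  else 68 * k + t

/-- Column map inside a crosscap block. -/
def gC (k t : ℕ) : ℕ := if t < 2 * k then t else 34 * k + t

/-- Column map inside the three special crosscap blocks. -/
def gS (k t : ℕ) : ℕ := if t < 2 * k then t else 110 * k + t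

/-- The (0-indexed) column map from the small grid to the big grid. -/
def f (k h j : ℕ) : ℕ :=
  if j < 4 * (k * h) + 4 * k then 72 * (k * (j / (4 * k))) + gH k (j % (4 * k))
  else if j < 4 * (k * h) + 16 * k then
    72 * (k * h) + 72 * k + gS k (j - (4 * (k * h) + 4 * k))
  else 72 * (k * (j / (4 * k))) - 72 * k + gC k (j % (4 * k))

/-- Left columns of the arcs. -/
def aL (k w : ℕ) : ℕ :=
  if w < 4 * k then 72 * k - 1 - w else if w < 8 * k then 58 * k - 1 - w
  else if w < 12 * k then 30 * k - 1 - w else if w < 14 * k then 98 * k - 1 - w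
  else 18 * k - 1 - w

/-- Right columns of the arcs. -/
def aR (k w : ℕ) : ℕ := if w < 12 * k then 72 * k + w else 96 * k + w

/-- Depths of the arcs. -/
def aD (k w : ℕ) : ℕ := if w < 12 * k then w else if w < 14 * k then w - 12 * k else w - 2 * k

/-- Owners of the arcs. -/
def own (k w : ℕ) : ℕ :=
  if w < 2 * k then 10 * k - 1 - w else if w < 4 * k then 8 * k - 1 - w
  else if w < 6 * k then w - 4 * k else if w < 8 * k then w - 2 * k
  else if w < 10 * k then w - 4 * k else if w < 12 * k then w - 2 * k
  else if w < 14 * k then 22 * k - 1 - w else 20 * k - 1 - w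

/-- The point `(r, c)` lies on arc `w`. -/
def OnArc (k h w r c : ℕ) : Prop :=
  ((c = 72 * (k * h) + 72 * k + aL k w ∨ c = 72 * (k * h) + 72 * k + aR k w) ∧ r ≤ aD k w) ∨
  (r = aD k w ∧ 72 * (k * h) + 72 * k + aL k w ≤ c ∧ c ≤ 72 * (k * h) + 72 * k + aR k w)

/-- The point `(r, c)` of the big grid lies in the branch set of `(i, j)`. -/
def In (k h i j r c : ℕ) : Prop :=
  (r = 17 * k + i ∧ f k h j ≤ c ∧ c < f k h (j + 1)) ∨
  (i = 0 ∧ c = f k h j ∧ r ≤ 17 * k) ∨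
  (i = 0 ∧ ∃ w, w < 16 * k ∧ j = 4 * (k * h) + 4 * k + own k w ∧ OnArc k h w r c)

/-- Splitting a column number into block and offset. -/
lemma split_col (k j : ℕ) (hk : 1 ≤ k) : ∃ q t, j = 4 * (k * q) + t ∧ t < 4 * k := by
  refine ⟨j / (4 * k), j % (4 * k), ?_, Nat.mod_lt _ (by omega)⟩
  have := Nat.div_add_mod j (4 * k)
  rw [← mul_assoc, this]

lemma divmod (k q t : ℕ) (ht : t < 4 * k) :
    (4 * (k * q) + t) / (4 * k) = q ∧ (4 * (k * q) + t) % (4 * k) = t := by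
  have hk : 0 < 4 * k := by omega
  rw [← mul_assoc]
  constructor
  · rw [Nat.mul_add_div hk, Nat.div_eq_of_lt ht, add_zero]
  · rw [Nat.mul_add_mod, Nat.mod_eq_of_lt ht]

lemma f_handle (k h q t : ℕ) (ht : t < 4 * k) (hq : q ≤ h) :
    f k h (4 * (k * q) + t) = 72 * (k * q) + gH k t := by
  have h1 := Nat.mul_le_mul_left k hq
  obtain ⟨h2, h3⟩ := divmod k q t ht
  unfold f
  rw [if_pos (by omega), h2, h3]

lemma f_special (k h t : ℕ) (ht : t < 12 * k) :
    f k h (4 * (k * h) + 4 * k + t) = 72 * (k * h) + 72 * k + gS k t := by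
  unfold f
  rw [if_neg (by omega), if_pos (by omega), Nat.add_sub_cancel_left]

lemma f_cross (k h q t : ℕ) (ht : t < 4 * k) (hq : h + 4 ≤ q) :
    f k h (4 * (k * q) + t) = 72 * (k * q) - 72 * k + gC k t := by
  have h1 := Nat.mul_le_mul_left k hq
  have h4 : k * (h + 4) = k * h + 4 * k := by ring
  obtain ⟨h2, h3⟩ := divmod k q t ht
  unfold f
  rw [if_neg (by omega), if_neg (by omega), h2, h3]

lemma f_zero (k h : ℕ) (hk : 1 ≤ k) : f k h 0 = 0 := by
  have := f_handle k h 0 0 (by omega) (by omega)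
  simpa [gH, show 0 < k by omega] using this

lemma f_step (k h j : ℕ) (hk : 1 ≤ k) : f k h j < f k h (j + 1) := by
  obtain ⟨q, t, rfl, ht⟩ := split_col k j hk
  have e1 : k * (q + 1) = k * q + k := by ring
  by_cases hq : q ≤ h
  · rw [f_handle k h q t ht hq]
    by_cases ht' : t + 1 < 4 * k
    · rw [add_assoc, f_handle k h q (t + 1) ht' hq]
      unfold gH; split_ifs <;> omega
    · by_cases hq' : q = h
      · subst hq'
        rw [show 4 * (k * q) + t + 1 = 4 * (k * q) + 4 * k + 0 by omega, f_special _ _ _ (by omega)]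
        unfold gH gS; split_ifs <;> omega
      · rw [show 4 * (k * q) + t + 1 = 4 * (k * (q + 1)) + 0 by omega,
          f_handle _ _ _ _ (by omega) (by omega)]
        unfold gH; split_ifs <;> omega
  · by_cases hq3 : q ≤ h + 3
    · have e2 := Nat.mul_le_mul_left k hq3
      have e3 : k * (h + 3) = k * h + 3 * k := by ring
      have e4 := Nat.mul_le_mul_left k (show h + 1 ≤ q by omega)
      have e5 : k * (h + 1) = k * h + k := by ring
      obtain ⟨s, hs⟩ : ∃ s, 4 * (k * q) + t = 4 * (k * h) + 4 * k + s :=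
        ⟨4 * (k * q) + t - (4 * (k * h) + 4 * k), by omega⟩
      rw [hs, f_special _ _ _ (by omega)]
      by_cases hs' : s + 1 < 12 * k
      · rw [add_assoc _ s 1, f_special _ _ _ hs']
        unfold gS; split_ifs <;> omega
      · have e6 : k * (h + 4) = k * h + 4 * k := by ring
        rw [show 4 * (k * h) + 4 * k + s + 1 = 4 * (k * (h + 4)) + 0 by omega,
          f_cross _ _ _ _ (by omega) (by omega)]
        unfold gS gC; split_ifs <;> omega
    · have e4 := Nat.mul_le_mul_left k (show h + 4 ≤ q by omega)
      have e5 : k * (h + 4) = k * h + 4 * k := by ring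
      rw [f_cross _ _ _ _ ht (by omega)]
      by_cases ht' : t + 1 < 4 * k
      · rw [add_assoc, f_cross k h q (t + 1) ht' (by omega)]
        unfold gC; split_ifs <;> omega
      · rw [show 4 * (k * q) + t + 1 = 4 * (k * (q + 1)) + 0 by omega,
          f_cross _ _ _ _ (by omega) (by omega)]
        unfold gC; split_ifs <;> omega

lemma f_mono (k h : ℕ) (hk : 1 ≤ k) : StrictMono (f k h) :=
  strictMono_nat_of_lt_succ (fun j => f_step k h j hk)

/-- Where the legs are, relative to the special region. -/
lemma f_region (k h j : ℕ) (hk : 1 ≤ k) :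
    f k h j < 72 * (k * h) + 74 * k ∨ 72 * (k * h) + 184 * k ≤ f k h j := by
  by_cases hj : j < 4 * (k * h) + 4 * k + 2 * k
  · left
    have h1 : f k h j ≤ f k h (4 * (k * h) + 4 * k + (2 * k - 1)) :=
      (f_mono k h hk).monotone (by omega)
    rw [f_special _ _ _ (by omega)] at h1
    unfold gS at h1
    rw [if_pos (by omega)] at h1
    omega
  · right
    have h1 : f k h (4 * (k * h) + 4 * k + 2 * k) ≤ f k h j :=
      (f_mono k h hk).monotone (by omega)
    rw [f_special _ _ _ (by omega)] at h1
    unfold gS at h1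
    rw [if_neg (by omega)] at h1
    omega

lemma arc_bounds (k w : ℕ) (hw : w < 16 * k) :
    2 * k ≤ aL k w ∧ aL k w < aR k w ∧ aR k w < 112 * k ∧ aD k w < 14 * k := by
  unfold aL aR aD; split_ifs <;> omega

lemma arc_cases (k w : ℕ) :
    (w < 4 * k ∧ aL k w = 72 * k - 1 - w ∧ aR k w = 72 * k + w ∧ aD k w = w) ∨
    (4 * k ≤ w ∧ w < 8 * k ∧ aL k w = 58 * k - 1 - w ∧ aR k w = 72 * k + w ∧ aD k w = w) ∨
    (8 * k ≤ w ∧ w < 12 * k ∧ aL k w = 30 * k - 1 - w ∧ aR k w = 72 * k + w ∧ aD k w = w) ∨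
    (12 * k ≤ w ∧ w < 14 * k ∧ aL k w = 98 * k - 1 - w ∧ aR k w = 96 * k + w ∧
      aD k w = w - 12 * k) ∨
    (14 * k ≤ w ∧ aL k w = 18 * k - 1 - w ∧ aR k w = 96 * k + w ∧ aD k w = w - 2 * k) := by
  unfold aL aR aD; split_ifs <;> omega

lemma arc_unique (k h w w' r c : ℕ) (hw : w < 16 * k) (hw' : w' < 16 * k)
    (h1 : OnArc k h w r c) (h2 : OnArc k h w' r c) : w = w' := by
  unfold OnArc at h1 h2
  generalize 72 * (k * h) = m at *
  rcases arc_cases k w with ⟨_, a, b, d⟩ | ⟨_, _, a, b, d⟩ | ⟨_, _, a, b, d⟩ | ⟨_, _, a, b, d⟩ |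
    ⟨_, a, b, d⟩ <;>
  rcases arc_cases k w' with ⟨_, a', b', d'⟩ | ⟨_, _, a', b', d'⟩ | ⟨_, _, a', b', d'⟩ |
    ⟨_, _, a', b', d'⟩ | ⟨_, a', b', d'⟩ <;>
  rw [a, b, d] at h1 <;> rw [a', b', d'] at h2 <;> clear a b d a' b' d' <;>
  rcases h1 with ⟨h1 | h1, _⟩ | ⟨_, _, _⟩ <;> rcases h2 with ⟨h2 | h2, _⟩ | ⟨_, _, _⟩ <;> omega

lemma In_unique (k h i j i' j' r c : ℕ) (hk : 1 ≤ k)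
    (h1 : In k h i j r c) (h2 : In k h i' j' r c) : i = i' ∧ j = j' := by
  have hm := f_mono k h hk
  have key : ∀ {a b : ℕ}, f k h a ≤ c → c < f k h (a + 1) → f k h b ≤ c → c < f k h (b + 1) →
      a = b := by
    intro a b p1 p2 p3 p4
    have := hm.lt_iff_lt.1 (lt_of_le_of_lt p1 p4)
    have := hm.lt_iff_lt.1 (lt_of_le_of_lt p3 p2)
    omega
  have hj := f_step k h j hk
  have hj' := f_step k h j' hk
  rcases h1 with ⟨a1, a2, a3⟩ | ⟨a1, a2, a3⟩ | ⟨a1, w, a2, a3, a4⟩ <;>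
  rcases h2 with ⟨b1, b2, b3⟩ | ⟨b1, b2, b3⟩ | ⟨b1, w', b2, b3, b4⟩
  · exact ⟨by omega, key a2 a3 b2 b3⟩
  · exact ⟨by omega, key a2 a3 (by omega) (by omega)⟩
  · have := arc_bounds k w' b2
    unfold OnArc at b4; omega
  · exact ⟨by omega, key (by omega) (by omega) b2 b3⟩
  · exact ⟨by omega, key (by omega) (by omega) (by omega) (by omega)⟩
  · have := arc_bounds k w' b2
    have := f_region k h j hk
    unfold OnArc at b4; omega
  · have := arc_bounds k w a2
    unfold OnArc at a4; omega
  · have := arc_bounds k w a2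
    have := f_region k h j' hk
    unfold OnArc at a4; omega
  · have := arc_unique k h w w' r c a2 b2 a4 b4
    subst this
    omega

/-- Edges of the big grid on the level of natural-number coordinates. -/
def NE (k h c : ℕ) (p q : ℕ × ℕ) : Prop :=
  (p.1 = q.1 ∧ q.2 = p.2 + 1) ∨ (p.2 = q.2 ∧ q.1 = p.1 + 1) ∨
  (p.1 = 0 ∧ q.1 = 0 ∧ ∃ b t, 1 ≤ b ∧ b ≤ h + 1 ∧ t < 18 * k ∧
    ((p.2 = 72 * (k * b) + t ∧ q.2 = 72 * (k * b) + 54 * k - 1 - t) ∨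
     (p.2 = 72 * (k * b) + 18 * k + t ∧ q.2 = 72 * (k * b) + 72 * k - 1 - t))) ∨
  (p.1 = 0 ∧ q.1 = 0 ∧ ∃ b t, h + 2 ≤ b ∧ b ≤ h + c + 2 ∧ t < 36 * k ∧
    p.2 = 72 * (k * b) + t ∧ q.2 = 72 * (k * b) + 36 * k + t)

/-- The embedding of natural-number coordinates into the vertex set of the big grid. -/
def phi (K N : ℕ) [NeZero K] (p : ℕ × ℕ) : Fin K × ZMod N :=
  (Fin.ofNat K p.1, ((p.2 + 1 : ℕ) : ZMod N))

lemma phi_fst (K N : ℕ) [NeZero K] (p : ℕ × ℕ) (hp : p.1 < K) : ((phi K N p).1 : ℕ) = p.1 := by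
  simp [phi, Nat.mod_eq_of_lt hp]

lemma phi_snd (K N : ℕ) [NeZero K] (p : ℕ × ℕ) (hp : p.2 < N) :
    ((phi K N p).2 - 1).val = p.2 := by
  simp [phi, ZMod.val_natCast, Nat.mod_eq_of_lt hp]

lemma phi_surj (K N : ℕ) [NeZero K] [NeZero N] (p : Fin K × ZMod N) :
    phi K N ((p.1 : ℕ), (p.2 - 1).val) = p := by
  ext
  · simp [phi]
  · simp [phi]

lemma phi_ne (K N : ℕ) [NeZero K] (p q : ℕ × ℕ) (hp : p.1 < K) (hp' : p.2 < N)
    (hq : q.1 < K) (hq' : q.2 < N) (h : p ≠ q) : phi K N p ≠ phi K N q := by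
  intro e
  apply h
  ext
  · rw [← phi_fst K N p hp, e, phi_fst K N q hq]
  · rw [← phi_snd K N p hp', e, phi_snd K N q hq']

/-- The big grid. -/
abbrev Big (k h c n : ℕ) : SimpleGraph (Fin (18 * k) × ZMod (4 * n * (18 * k))) :=
  mixedGrid (18 * k) n (Finset.Icc 2 (h + 2)) (Finset.Icc (h + 3) (h + c + 3))

lemma NE_adj (k h c n : ℕ) [NeZero (18 * k)] (p q : ℕ × ℕ)
    (hp : p.1 < 18 * k) (hp' : p.2 < 4 * n * (18 * k)) (hq : q.1 < 18 * k)
    (hq' : q.2 < 4 * n * (18 * k)) (h1 : NE k h c p q) :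
    (Big k h c n).Adj (phi _ _ p) (phi _ _ q) := by
  have hne : p ≠ q := by
    rintro rfl
    rcases h1 with h1 | h1 | ⟨_, _, b, t, h1⟩ | ⟨_, _, b, t, h1⟩ <;> omega
  unfold Big mixedGrid
  rw [SimpleGraph.fromRel_adj]
  refine ⟨phi_ne _ _ p q hp hp' hq hq' hne, Or.inl ?_⟩
  rw [phi_fst _ _ p hp, phi_fst _ _ q hq]
  rcases h1 with ⟨h1, h2⟩ | ⟨h1, h2⟩ | ⟨z1, z2, b, t, h1, h2, h3, h4⟩ |
    ⟨z1, z2, b, t, h1, h2, h3, h4, h5⟩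
  · left
    refine ⟨?_, ?_⟩
    · apply Fin.ext; rw [phi_fst _ _ p hp, phi_fst _ _ q hq, h1]
    · simp [phi, h2]
  · right; left
    exact ⟨by simp [phi, h1], h2⟩
  · right; right; left
    have e : 4 * (18 * k) * (b + 1 - 1) = 72 * (k * b) := by
      rw [Nat.add_sub_cancel]; ring
    refine ⟨z1, z2, b + 1, Finset.mem_Icc.2 (by omega), t + 1, Finset.mem_Icc.2 (by omega), ?_⟩
    rw [e]
    rcases h4 with ⟨h4, h5⟩ | ⟨h4, h5⟩
    · left
      exact ⟨congrArg Nat.cast (by omega), congrArg Nat.cast (by omega)⟩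
    · right
      exact ⟨congrArg Nat.cast (by omega), congrArg Nat.cast (by omega)⟩
  · right; right; right
    have e : 4 * (18 * k) * (b + 1 - 1) = 72 * (k * b) := by
      rw [Nat.add_sub_cancel]; ring
    refine ⟨z1, z2, b + 1, Finset.mem_Icc.2 (by omega), t + 1, Finset.mem_Icc.2 (by omega), ?_⟩
    rw [e]
    exact ⟨congrArg Nat.cast (by omega), congrArg Nat.cast (by omega)⟩

lemma wrap_adj (k h c n r : ℕ) [NeZero (18 * k)] (hn : 1 ≤ n) (hk : 1 ≤ k) (hr : r < 18 * k) :
    (Big k h c n).Adj (phi _ _ (r, 4 * n * (18 * k) - 1)) (phi _ _ (r, 0)) := by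
  have hN : 72 ≤ 4 * n * (18 * k) := by nlinarith [Nat.mul_le_mul hn hk]
  unfold Big mixedGrid
  rw [SimpleGraph.fromRel_adj]
  refine ⟨phi_ne _ _ _ _ hr (by dsimp; omega) hr (by dsimp; omega) (by simp; omega),
    Or.inl (Or.inl ⟨rfl, ?_⟩)⟩
  have : ((4 * n * (18 * k) - 1 + 1 : ℕ) : ZMod (4 * n * (18 * k))) = 0 := by
    rw [Nat.sub_add_cancel (by omega)]; exact ZMod.natCast_self _
  simp only [phi]
  rw [this]; simp

/-- One step inside a branch set, on natural-number coordinates. -/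
def Step (k h c i j : ℕ) (p q : ℕ × ℕ) : Prop :=
  In k h i j p.1 p.2 ∧ In k h i j q.1 q.2 ∧ (NE k h c p q ∨ NE k h c q p)

/-- Reachability inside a branch set. -/
abbrev Rch (k h c i j : ℕ) : ℕ × ℕ → ℕ × ℕ → Prop := Relation.ReflTransGen (Step k h c i j)

lemma Rch_symm {k h c i j : ℕ} {p q : ℕ × ℕ} (h1 : Rch k h c i j p q) : Rch k h c i j q p := by
  haveI : Std.Symm (Step k h c i j) := ⟨fun _ _ ⟨x, y, z⟩ => ⟨y, x, z.symm⟩⟩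
  exact (Relation.ReflTransGen.stdSymm (r := Step k h c i j)).symm _ _ h1

lemma Rch_edge {k h c i j : ℕ} {p q : ℕ × ℕ} (hp : In k h i j p.1 p.2) (hq : In k h i j q.1 q.2)
    (h1 : NE k h c p q) : Rch k h c i j p q := Relation.ReflTransGen.single ⟨hp, hq, Or.inl h1⟩

lemma Rch_horiz {k h c i j r a : ℕ} (d : ℕ)
    (H : ∀ x, a ≤ x → x ≤ a + d → In k h i j r x) : Rch k h c i j (r, a) (r, a + d) := by
  induction d with
  | zero => exact Relation.ReflTransGen.refl
  | succ d ih =>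
    refine (ih (fun x h1 h2 => H x h1 (by omega))).trans (Rch_edge (H _ (by omega) (by omega))
      (H _ (by omega) (by omega)) (Or.inl ⟨rfl, rfl⟩))

lemma Rch_vert {k h c i j r a : ℕ} (d : ℕ)
    (H : ∀ x, r ≤ x → x ≤ r + d → In k h i j x a) : Rch k h c i j (r, a) (r + d, a) := by
  induction d with
  | zero => exact Relation.ReflTransGen.refl
  | succ d ih =>
    refine (ih (fun x h1 h2 => H x h1 (by omega))).trans (Rch_edge (H _ (by omega) (by omega))
      (H _ (by omega) (by omega)) (Or.inr (Or.inl ⟨rfl, rfl⟩)))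

lemma Rch_horiz' {k h c i j r a b : ℕ} (hab : a ≤ b)
    (H : ∀ x, a ≤ x → x ≤ b → In k h i j r x) : Rch k h c i j (r, a) (r, b) := by
  obtain ⟨d, rfl⟩ := Nat.exists_eq_add_of_le hab
  exact Rch_horiz d H

lemma Rch_vert' {k h c i j r s a : ℕ} (hab : r ≤ s)
    (H : ∀ x, r ≤ x → x ≤ s → In k h i j x a) : Rch k h c i j (r, a) (s, a) := by
  obtain ⟨d, rfl⟩ := Nat.exists_eq_add_of_le hab
  exact Rch_vert d H

/-- Abbreviation for the owner of arc `w` as a column of the small grid. -/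
abbrev oc (k h w : ℕ) : ℕ := 4 * (k * h) + 4 * k + own k w

lemma In_arc {k h w r c : ℕ} (hw : w < 16 * k) (h1 : OnArc k h w r c) :
    In k h 0 (oc k h w) r c := Or.inr (Or.inr ⟨rfl, w, hw, rfl, h1⟩)

/-- The top left end of arc `w`. -/
abbrev pL (k h w : ℕ) : ℕ × ℕ := (0, 72 * (k * h) + 72 * k + aL k w)
/-- The top right end of arc `w`. -/
abbrev pR (k h w : ℕ) : ℕ × ℕ := (0, 72 * (k * h) + 72 * k + aR k w)

lemma In_L {k h w : ℕ} (hw : w < 16 * k) : In k h 0 (oc k h w) (pL k h w).1 (pL k h w).2 :=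
  In_arc hw (Or.inl ⟨Or.inl rfl, Nat.zero_le _⟩)

lemma In_R {k h w : ℕ} (hw : w < 16 * k) : In k h 0 (oc k h w) (pR k h w).1 (pR k h w).2 :=
  In_arc hw (Or.inl ⟨Or.inr rfl, Nat.zero_le _⟩)

lemma arc_from_L {k h c w r x : ℕ} (hw : w < 16 * k) (h1 : OnArc k h w r x) :
    Rch k h c 0 (oc k h w) (pL k h w) (r, x) := by
  have hb := arc_bounds k w hw
  have down : ∀ r ≤ aD k w, Rch k h c 0 (oc k h w) (pL k h w)
      (r, 72 * (k * h) + 72 * k + aL k w) := fun r hr =>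
    Rch_vert' (Nat.zero_le _) (fun x _ hx => In_arc hw (Or.inl ⟨Or.inl rfl, by omega⟩))
  have mid : ∀ x, 72 * (k * h) + 72 * k + aL k w ≤ x → x ≤ 72 * (k * h) + 72 * k + aR k w →
      Rch k h c 0 (oc k h w) (pL k h w) (aD k w, x) := fun x h2 h3 =>
    (down _ le_rfl).trans (Rch_horiz' h2 (fun y h4 h5 => In_arc hw (Or.inr ⟨rfl, h4, by omega⟩)))
  rcases h1 with ⟨rfl | rfl, h2⟩ | ⟨rfl, h2, h3⟩
  · exact down r h2
  · refine (mid _ (by omega) le_rfl).trans (Rch_symm (Rch_vert' h2 (fun x _ hx =>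
      In_arc hw (Or.inl ⟨Or.inr rfl, hx⟩))))
  · exact mid x h2 h3

lemma arc_LR {k h c w : ℕ} (hw : w < 16 * k) :
    Rch k h c 0 (oc k h w) (pL k h w) (pR k h w) :=
  arc_from_L hw (Or.inl ⟨Or.inr rfl, Nat.zero_le _⟩)

/-- The root of a branch set. -/
abbrev root (k h i j : ℕ) : ℕ × ℕ := (17 * k + i, f k h j)

lemma In_leg {k h j r : ℕ} (hr : r ≤ 17 * k) : In k h 0 j r (f k h j) :=
  Or.inr (Or.inl ⟨rfl, rfl, hr⟩)

lemma leg_conn {k h c j r : ℕ} (hr : r ≤ 17 * k) :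
    Rch k h c 0 j (root k h 0 j) (r, f k h j) :=
  Rch_symm (Rch_vert' hr (fun _ _ hx => In_leg hx))

/-- Band edges of the special handle, first kind. -/
lemma NE_A {k h c x y : ℕ} (hx : x < 18 * k) (hxy : x + y + 1 = 54 * k) :
    NE k h c (0, 72 * (k * h) + 72 * k + x) (0, 72 * (k * h) + 72 * k + y) := by
  have e : k * (h + 1) = k * h + k := by ring
  exact Or.inr (Or.inr (Or.inl ⟨rfl, rfl, h + 1, x, by omega, by omega, hx,
    Or.inl ⟨by dsimp only; omega, by dsimp only; omega⟩⟩))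

/-- Band edges of the special handle, second kind. -/
lemma NE_B {k h c x y : ℕ} (hx : x < 36 * k) (hx' : 18 * k ≤ x) (hxy : x + y + 1 = 90 * k) :
    NE k h c (0, 72 * (k * h) + 72 * k + x) (0, 72 * (k * h) + 72 * k + y) := by
  have e : k * (h + 1) = k * h + k := by ring
  exact Or.inr (Or.inr (Or.inl ⟨rfl, rfl, h + 1, x - 18 * k, by omega, by omega, by omega,
    Or.inr ⟨by dsimp only; omega, by dsimp only; omega⟩⟩))

/-- Band edges of the special crosscap. -/
lemma NE_C {k h c x y : ℕ} (hx : x < 108 * k) (hx' : 72 * k ≤ x) (hxy : y = x + 36 * k) :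
    NE k h c (0, 72 * (k * h) + 72 * k + x) (0, 72 * (k * h) + 72 * k + y) := by
  have e : k * (h + 2) = k * h + 2 * k := by ring
  exact Or.inr (Or.inr (Or.inr ⟨rfl, rfl, h + 2, x - 72 * k, by omega, by omega, by omega,
    by dsimp only; omega, by dsimp only; omega⟩))

/-- Legs in the special region. -/
lemma f_own {k h w : ℕ} (hw : w < 16 * k) :
    f k h (oc k h w) = 72 * (k * h) + 72 * k + gS k (own k w) :=
  f_special _ _ _ (by unfold own; split_ifs <;> omega)

lemma own_cases (k w : ℕ) :
    (w < 2 * k ∧ own k w = 10 * k - 1 - w) ∨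
    (2 * k ≤ w ∧ w < 4 * k ∧ own k w = 8 * k - 1 - w) ∨
    (4 * k ≤ w ∧ w < 6 * k ∧ own k w = w - 4 * k) ∨
    (6 * k ≤ w ∧ w < 8 * k ∧ own k w = w - 2 * k) ∨
    (8 * k ≤ w ∧ w < 10 * k ∧ own k w = w - 4 * k) ∨
    (10 * k ≤ w ∧ w < 12 * k ∧ own k w = w - 2 * k) ∨
    (12 * k ≤ w ∧ w < 14 * k ∧ own k w = 22 * k - 1 - w) ∨
    (14 * k ≤ w ∧ own k w = 20 * k - 1 - w) := by
  unfold own; split_ifs <;> omega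

/-- Arcs reached directly from a leg at their left end. -/
lemma conn_x {k h c w : ℕ} (h1 : 4 * k ≤ w) (h2 : w < 6 * k) :
    Rch k h c 0 (oc k h w) (root k h 0 (oc k h w)) (pL k h w) := by
  have hw : w < 16 * k := by omega
  refine (leg_conn (Nat.zero_le _)).trans ?_
  have hi := In_leg (k := k) (h := h) (j := oc k h w) (Nat.zero_le _)
  have := own_cases k w
  have := arc_cases k w
  have e : gS k (own k w) = own k w := by unfold gS; rw [if_pos (by omega)]
  rw [f_own hw] at hi ⊢
  exact Rch_edge hi (In_L hw) (NE_A (by omega) (by omega))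

/-- Arcs reached directly from a leg at their right end. -/
lemma conn_yz {k h c w : ℕ} (h1 : 6 * k ≤ w ∧ w < 8 * k ∨ 10 * k ≤ w ∧ w < 12 * k) :
    Rch k h c 0 (oc k h w) (root k h 0 (oc k h w)) (pR k h w) := by
  have hw : w < 16 * k := by omega
  refine (leg_conn (Nat.zero_le _)).trans ?_
  have hi := In_leg (k := k) (h := h) (j := oc k h w) (Nat.zero_le _)
  have := own_cases k w
  have := arc_cases k w
  have e : gS k (own k w) = 110 * k + own k w := by unfold gS; rw [if_neg (by omega)]
  rw [f_own hw] at hi ⊢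
  exact Rch_symm (Rch_edge (In_R hw) hi (NE_C (by omega) (by omega) (by omega)))

lemma hop_LL {k h c w w' : ℕ} (hw : w < 16 * k) (hw' : w' < 16 * k) (ho : own k w = own k w')
    (hne : NE k h c (pL k h w) (pL k h w') ∨ NE k h c (pL k h w') (pL k h w))
    (hc : Rch k h c 0 (oc k h w) (root k h 0 (oc k h w)) (pL k h w)) :
    Rch k h c 0 (oc k h w') (root k h 0 (oc k h w')) (pL k h w') := by
  have e : oc k h w = oc k h w' := by unfold oc; rw [ho]
  have i1 := In_L (h := h) hw
  have i2 := In_L (h := h) hw'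
  rw [e] at hc i1
  exact hc.trans (Relation.ReflTransGen.single ⟨i1, i2, hne⟩)

lemma hop_RR {k h c w w' : ℕ} (hw : w < 16 * k) (hw' : w' < 16 * k) (ho : own k w = own k w')
    (hne : NE k h c (pR k h w) (pR k h w') ∨ NE k h c (pR k h w') (pR k h w))
    (hc : Rch k h c 0 (oc k h w) (root k h 0 (oc k h w)) (pL k h w)) :
    Rch k h c 0 (oc k h w') (root k h 0 (oc k h w')) (pL k h w') := by
  have e : oc k h w = oc k h w' := by unfold oc; rw [ho]
  have i1 := In_R (h := h) hw
  have i2 := In_R (h := h) hw'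
  have a1 := arc_LR (c := c) (h := h) hw
  rw [e] at hc i1 a1
  exact ((hc.trans a1).trans (Relation.ReflTransGen.single ⟨i1, i2, hne⟩)).trans
    (Rch_symm (arc_LR hw'))

lemma conn_arc {k h c w : ℕ} (hw : w < 16 * k) :
    Rch k h c 0 (oc k h w) (root k h 0 (oc k h w)) (pL k h w) := by
  -- arcs whose right end meets a leg
  have s1 : ∀ w, (6 * k ≤ w ∧ w < 8 * k ∨ 10 * k ≤ w ∧ w < 12 * k) →
      Rch k h c 0 (oc k h w) (root k h 0 (oc k h w)) (pL k h w) := fun w h1 =>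
    (conn_yz h1).trans (Rch_symm (arc_LR (by omega)))
  have s2 : ∀ w, 14 * k ≤ w → w < 16 * k →
      Rch k h c 0 (oc k h w) (root k h 0 (oc k h w)) (pL k h w) := by
    intro w h1 h2
    have := own_cases k w
    have := own_cases k (22 * k - 1 - w)
    have := arc_cases k w
    have := arc_cases k (22 * k - 1 - w)
    exact hop_LL (w := 22 * k - 1 - w) (by omega) (by omega) (by omega)
      (Or.inr (NE_A (by omega) (by omega))) (s1 _ (by omega))
  have s3 : ∀ w, 2 * k ≤ w → w < 4 * k →
      Rch k h c 0 (oc k h w) (root k h 0 (oc k h w)) (pL k h w) := by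
    intro w h1 h2
    have := own_cases k w
    have := own_cases k (12 * k + w)
    have := arc_cases k w
    have := arc_cases k (12 * k + w)
    exact hop_RR (w := 12 * k + w) (by omega) (by omega) (by omega)
      (Or.inr (NE_C (by omega) (by omega) (by omega))) (s2 _ (by omega) (by omega))
  have s4 : ∀ w, 8 * k ≤ w → w < 10 * k →
      Rch k h c 0 (oc k h w) (root k h 0 (oc k h w)) (pL k h w) := by
    intro w h1 h2
    have := own_cases k w
    have := own_cases k (12 * k - 1 - w)
    have := arc_cases k w
    have := arc_cases k (12 * k - 1 - w)
    exact hop_LL (w := 12 * k - 1 - w) (by omega) (by omega) (by omega)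
      (Or.inr (NE_B (by omega) (by omega) (by omega))) (s3 _ (by omega) (by omega))
  have s5 : ∀ w, w < 2 * k →
      Rch k h c 0 (oc k h w) (root k h 0 (oc k h w)) (pL k h w) := by
    intro w h1
    have := own_cases k w
    have := own_cases k (12 * k - 1 - w)
    have := arc_cases k w
    have := arc_cases k (12 * k - 1 - w)
    exact hop_LL (w := 12 * k - 1 - w) (by omega) (by omega) (by omega)
      (Or.inl (NE_B (by omega) (by omega) (by omega))) (s1 _ (by omega))
  have s6 : ∀ w, 12 * k ≤ w → w < 14 * k →
      Rch k h c 0 (oc k h w) (root k h 0 (oc k h w)) (pL k h w) := by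
    intro w h1 h2
    have := own_cases k w
    have := own_cases k (w - 12 * k)
    have := arc_cases k w
    have := arc_cases k (w - 12 * k)
    exact hop_RR (w := w - 12 * k) (by omega) (by omega) (by omega)
      (Or.inl (NE_C (by omega) (by omega) (by omega))) (s5 _ (by omega))
  rcases own_cases k w with ⟨_, _⟩ | ⟨_, _, _⟩ | ⟨_, _, _⟩ | ⟨_, _, _⟩ | ⟨_, _, _⟩ | ⟨_, _, _⟩ |
    ⟨_, _, _⟩ | ⟨_, _⟩
  · exact s5 w (by omega)
  · exact s3 w (by omega) (by omega)
  · exact conn_x (by omega) (by omega)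
  · exact s1 w (by omega)
  · exact s4 w (by omega) (by omega)
  · exact s1 w (by omega)
  · exact s6 w (by omega) (by omega)
  · exact s2 w (by omega) (by omega)

lemma In_root {k h i j : ℕ} (hk : 1 ≤ k) : In k h i j (root k h i j).1 (root k h i j).2 :=
  Or.inl ⟨rfl, le_rfl, f_step k h j hk⟩

/-- Every point of a branch set is reachable from the root. -/
lemma conn_all {k h c i j r x : ℕ} (h1 : In k h i j r x) :
    Rch k h c i j (root k h i j) (r, x) := by
  rcases h1 with ⟨rfl, h2, h3⟩ | ⟨rfl, rfl, h2⟩ | ⟨rfl, w, hw, rfl, h2⟩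
  · exact Rch_horiz' h2 (fun y h4 h5 => Or.inl ⟨rfl, h4, by omega⟩)
  · exact leg_conn h2
  · exact (conn_arc hw).trans (arc_from_L hw h2)

/-- Points of branch sets are inside the grid. -/
lemma In_bounds {k h c i j r x : ℕ} (hk : 1 ≤ k) (hi : i < k)
    (hj : j < 4 * (h + c + 4) * k) (h1 : In k h i j r x) :
    r < 18 * k ∧ x < 4 * (h + c + 3) * (18 * k) := by
  have hm := f_mono k h hk
  have e1 : 4 * (h + c + 4) * k = 4 * (k * (h + c + 4)) + 0 := by ring
  have e2 : 4 * (h + c + 3) * (18 * k) = 72 * (k * (h + c + 4)) - 72 * k := by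
    have : k * (h + c + 4) = k * (h + c + 3) + k := by ring
    rw [this]
    have : 4 * (h + c + 3) * (18 * k) = 72 * (k * (h + c + 3)) := by ring
    omega
  have e3 : f k h (j + 1) ≤ 4 * (h + c + 3) * (18 * k) := by
    have : f k h (j + 1) ≤ f k h (4 * (h + c + 4) * k) := hm.monotone hj
    rw [e1, f_cross _ _ _ _ (by omega) (by omega)] at this
    rw [e2]
    simpa [gC, show 0 < k from hk] using this
  have e4 := f_step k h j hk
  rcases h1 with ⟨h1, h2, h3⟩ | ⟨h1, h2, h3⟩ | ⟨h1, w, hw, h2, h3⟩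
  · omega
  · omega
  · have := arc_bounds k w hw
    have e5 : 72 * (k * h) + 216 * k ≤ 4 * (h + c + 3) * (18 * k) := by
      nlinarith [Nat.zero_le (k * c)]
    unfold OnArc at h3
    omega

/-- The branch sets of the minor model. -/
def X (k h n n' : ℕ) (u : Fin k × ZMod (4 * n * k)) :
    Set (Fin (18 * k) × ZMod (4 * n' * (18 * k))) :=
  {p | In k h (u.1 : ℕ) (u.2 - 1).val (p.1 : ℕ) (p.2 - 1).val}

lemma f_top (k h c : ℕ) (hk : 1 ≤ k) :
    f k h (4 * (h + c + 4) * k) = 4 * (h + c + 3) * (18 * k) := by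
  have e1 : 4 * (h + c + 4) * k = 4 * (k * (h + c + 4)) + 0 := by ring
  have e2 : k * (h + c + 4) = k * (h + c + 3) + k := by ring
  have e3 : 4 * (h + c + 3) * (18 * k) = 72 * (k * (h + c + 3)) := by ring
  rw [e1, f_cross _ _ _ _ (by omega) (by omega), e3, e2]
  simp only [gC]
  rw [if_pos (by omega)]
  omega

lemma phi_mem {k h c : ℕ} [NeZero (18 * k)] (hk : 1 ≤ k)
    (u : Fin k × ZMod (4 * (h + c + 4) * k)) (p : ℕ × ℕ)
    (hp : In k h (u.1 : ℕ) (u.2 - 1).val p.1 p.2) :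
    phi _ _ p ∈ X k h (h + c + 4) (h + c + 3) u := by
  haveI : NeZero (4 * (h + c + 4) * k) := ⟨by positivity⟩
  have hb := In_bounds hk u.1.2 (ZMod.val_lt (u.2 - 1)) hp
  unfold X
  rw [Set.mem_setOf_eq, phi_fst _ _ p hb.1, phi_snd _ _ p hb.2]
  exact hp

/-- An edge on natural-number coordinates yields an edge between branch sets. -/
lemma edge_lift {k h c : ℕ} [NeZero (18 * k)] (hk : 1 ≤ k)
    (u v : Fin k × ZMod (4 * (h + c + 4) * k)) (p q : ℕ × ℕ)
    (hp : In k h (u.1 : ℕ) (u.2 - 1).val p.1 p.2) (hq : In k h (v.1 : ℕ) (v.2 - 1).val q.1 q.2)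
    (hpq : NE k h c p q) :
    ∃ a ∈ X k h (h + c + 4) (h + c + 3) u, ∃ b ∈ X k h (h + c + 4) (h + c + 3) v,
      (Big k h c (h + c + 3)).Adj a b := by
  haveI : NeZero (4 * (h + c + 4) * k) := ⟨by positivity⟩
  have hb := In_bounds hk u.1.2 (ZMod.val_lt (u.2 - 1)) hp
  have hb' := In_bounds hk v.1.2 (ZMod.val_lt (v.2 - 1)) hq
  exact ⟨_, phi_mem hk u p hp, _, phi_mem hk v q hq,
    NE_adj k h c _ p q hb.1 hb.2 hb'.1 hb'.2 hpq⟩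

lemma X_connected {k h c : ℕ} (hk : 1 ≤ k) (u : Fin k × ZMod (4 * (h + c + 4) * k)) :
    ((Big k h c (h + c + 3)).induce (X k h (h + c + 4) (h + c + 3) u)).Connected := by
  haveI : NeZero (18 * k) := ⟨by omega⟩
  haveI : NeZero (4 * (h + c + 4) * k) := ⟨by positivity⟩
  haveI : NeZero (4 * (h + c + 3) * (18 * k)) := ⟨by positivity⟩
  have hu := ZMod.val_lt (u.2 - 1)
  have hr := phi_mem (c := c) hk u _ (In_root (h := h) (i := (u.1 : ℕ)) (j := (u.2 - 1).val) hk)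
  have key : ∀ p : ℕ × ℕ, Rch k h c (u.1 : ℕ) (u.2 - 1).val (root k h u.1 (u.2 - 1).val) p →
      ∃ hp : phi _ _ p ∈ X k h (h + c + 4) (h + c + 3) u,
      ((Big k h c (h + c + 3)).induce (X k h (h + c + 4) (h + c + 3) u)).Reachable
        ⟨_, hr⟩ ⟨_, hp⟩ := by
    intro p hp
    induction hp with
    | refl => exact ⟨hr, SimpleGraph.Reachable.refl _⟩
    | tail _ hs ih =>
      obtain ⟨hb, hreach⟩ := ih
      obtain ⟨s1, s2, s3⟩ := hs
      refine ⟨phi_mem hk u _ s2, hreach.trans (SimpleGraph.Adj.reachable ?_)⟩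
      have b1 := In_bounds hk u.1.2 hu s1
      have b2 := In_bounds hk u.1.2 hu s2
      rw [SimpleGraph.comap_adj]
      rcases s3 with s3 | s3
      · exact NE_adj k h c _ _ _ b1.1 b1.2 b2.1 b2.2 s3
      · exact (NE_adj k h c _ _ _ b2.1 b2.2 b1.1 b1.2 s3).symm
  rw [SimpleGraph.connected_iff_exists_forall_reachable]
  refine ⟨⟨_, hr⟩, ?_⟩
  rintro ⟨p, hp⟩
  obtain ⟨hp', hre⟩ := key _ (conn_all (c := c) hp)
  have e := phi_surj _ _ p
  convert hre using 2
  exact e.symm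

/-- The value of a column given by a cast. -/
lemma col_val {N m : ℕ} {x : ZMod N} (hx : x = (m : ZMod N)) (h1 : 1 ≤ m) (h2 : m ≤ N) :
    (x - 1).val = m - 1 := by
  obtain ⟨m, rfl⟩ := Nat.exists_eq_add_of_le' h1
  subst hx
  simp [ZMod.val_natCast, Nat.mod_eq_of_lt (show m < N by omega)]

lemma edge_rel {k h c : ℕ} (hk : 1 ≤ k)
    (u v : Fin k × ZMod (4 * (h + c + 4) * k))
    (H : (u.1 = v.1 ∧ v.2 = u.2 + 1) ∨
    (u.2 = v.2 ∧ (v.1 : ℕ) = (u.1 : ℕ) + 1) ∨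
    ((u.1 : ℕ) = 0 ∧ (v.1 : ℕ) = 0 ∧ ∃ i ∈ Finset.Icc 2 (h + 1), ∃ j ∈ Finset.Icc 1 k,
      ((u.2 = ((4 * k * (i - 1) + j : ℕ) : ZMod (4 * (h + c + 4) * k)) ∧
        v.2 = ((4 * k * (i - 1) + 3 * k - j + 1 : ℕ) : ZMod (4 * (h + c + 4) * k))) ∨
       (u.2 = ((4 * k * (i - 1) + k + j : ℕ) : ZMod (4 * (h + c + 4) * k)) ∧
        v.2 = ((4 * k * (i - 1) + 4 * k - j + 1 : ℕ) : ZMod (4 * (h + c + 4) * k))))) ∨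
    ((u.1 : ℕ) = 0 ∧ (v.1 : ℕ) = 0 ∧
      ∃ i ∈ Finset.Icc (h + 2) (h + c + 4), ∃ j ∈ Finset.Icc 1 (2 * k),
      u.2 = ((4 * k * (i - 1) + j : ℕ) : ZMod (4 * (h + c + 4) * k)) ∧
      v.2 = ((4 * k * (i - 1) + 2 * k + j : ℕ) : ZMod (4 * (h + c + 4) * k)))) :
    ∃ a ∈ X k h (h + c + 4) (h + c + 3) u, ∃ b ∈ X k h (h + c + 4) (h + c + 3) v,
      (Big k h c (h + c + 3)).Adj a b := by
  haveI : NeZero (18 * k) := ⟨by omega⟩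
  haveI : NeZero (4 * (h + c + 4) * k) := ⟨by positivity⟩
  have hNpos : 0 < 4 * (h + c + 4) * k := by positivity
  have hu := ZMod.val_lt (u.2 - 1)
  have hv := ZMod.val_lt (v.2 - 1)
  have hlift := edge_lift (c := c) hk u v
  have hmem := phi_mem (c := c) hk u
  have hmem' := phi_mem (c := c) hk v
  have eN : 4 * (h + c + 4) * k = 4 * (k * (h + c + 4)) := by ring
  rcases H with ⟨h1, h2⟩ | ⟨h1, h2⟩ | ⟨z1, z2, i, hi, j, hj, H⟩ | ⟨z1, z2, i, hi, j, hj, H1, H2⟩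
  · -- horizontal edges
    have e : (v.2 - 1).val = ((u.2 - 1).val + 1) % (4 * (h + c + 4) * k) := by
      have : v.2 - 1 = (((u.2 - 1).val + 1 : ℕ) : ZMod (4 * (h + c + 4) * k)) := by
        rw [h2]; simp
      rw [this, ZMod.val_natCast]
    rw [← h1] at hlift hmem'
    by_cases hc : (u.2 - 1).val + 1 < 4 * (h + c + 4) * k
    · rw [Nat.mod_eq_of_lt hc] at e
      rw [e] at hlift
      have s1 := f_step k h (u.2 - 1).val hk
      have s2 := f_step k h ((u.2 - 1).val + 1) hk
      refine hlift (17 * k + u.1, f k h ((u.2 - 1).val + 1) - 1)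
        (17 * k + u.1, f k h ((u.2 - 1).val + 1))
        (Or.inl ⟨rfl, by dsimp only; omega, by dsimp only; omega⟩)
        (Or.inl ⟨rfl, le_rfl, s2⟩) (Or.inl ⟨rfl, by dsimp only; omega⟩)
    · have e0 : (u.2 - 1).val + 1 = 4 * (h + c + 4) * k := by omega
      rw [e0, Nat.mod_self] at e
      have s1 := f_step k h (u.2 - 1).val hk
      have s2 := f_step k h 0 hk
      rw [e] at hmem'
      have ft := f_top k h c hk
      rw [← e0] at ft
      have hu1 := u.1.2
      refine ⟨_, hmem (17 * k + u.1, 4 * (h + c + 3) * (18 * k) - 1)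
          (Or.inl ⟨rfl, by dsimp only; omega, by dsimp only; omega⟩), _,
        hmem' (17 * k + u.1, 0) (Or.inl ⟨rfl, by rw [f_zero k h hk], by rw [f_zero k h hk] at s2; exact s2⟩),
        wrap_adj k h c _ _ (by omega) hk (by omega)⟩
  · -- vertical edges
    rw [← h1, h2] at hlift
    exact hlift (root k h u.1 (u.2 - 1).val) (root k h (u.1 + 1) (u.2 - 1).val)
      (In_root hk) (In_root hk) (Or.inr (Or.inl ⟨rfl, by dsimp only; omega⟩))
  · -- handles
    obtain ⟨b, rfl⟩ : ∃ b, i = b + 1 := ⟨i - 1, by have := Finset.mem_Icc.1 hi; omega⟩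
    have hi := Finset.mem_Icc.1 hi
    obtain ⟨t, rfl⟩ : ∃ t, j = t + 1 := ⟨j - 1, by have := Finset.mem_Icc.1 hj; omega⟩
    have hj := Finset.mem_Icc.1 hj
    have e : 4 * k * (b + 1 - 1) = 4 * (k * b) := by rw [Nat.add_sub_cancel]; ring
    have e2 := Nat.mul_le_mul_left k (show b + 1 ≤ h + c + 4 by omega)
    have e3 : k * (b + 1) = k * b + k := by ring
    rw [e] at H
    rw [z1, z2] at hlift
    rcases H with ⟨H1, H2⟩ | ⟨H1, H2⟩
    · rw [col_val H1 (by omega) (by omega), col_val H2 (by omega) (by omega)] at hlift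
      have f1 := f_handle k h b t (by omega) (by omega)
      have f2 := f_handle k h b (3 * k - 1 - t) (by omega) (by omega)
      have g1 : gH k t = t := by unfold gH; rw [if_pos (by omega)]
      have g2 : gH k (3 * k - 1 - t) = 54 * k - 1 - t := by unfold gH; split_ifs <;> omega
      rw [show 4 * (k * b) + (t + 1) - 1 = 4 * (k * b) + t by omega,
        show 4 * (k * b) + 3 * k - (t + 1) + 1 - 1 = 4 * (k * b) + (3 * k - 1 - t) by omega] at hlift
      refine hlift (0, f k h _) (0, f k h _) (In_leg (Nat.zero_le _)) (In_leg (Nat.zero_le _)) ?_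
      exact Or.inr (Or.inr (Or.inl ⟨rfl, rfl, b, t, by omega, by omega, by omega,
        Or.inl ⟨by dsimp only; omega, by dsimp only; omega⟩⟩))
    · rw [col_val H1 (by omega) (by omega), col_val H2 (by omega) (by omega)] at hlift
      have f1 := f_handle k h b (k + t) (by omega) (by omega)
      have f2 := f_handle k h b (4 * k - 1 - t) (by omega) (by omega)
      have g1 : gH k (k + t) = 18 * k + t := by unfold gH; split_ifs <;> omega
      have g2 : gH k (4 * k - 1 - t) = 72 * k - 1 - t := by unfold gH; split_ifs <;> omega
      rw [show 4 * (k * b) + k + (t + 1) - 1 = 4 * (k * b) + (k + t) by omega,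
        show 4 * (k * b) + 4 * k - (t + 1) + 1 - 1 = 4 * (k * b) + (4 * k - 1 - t) by omega] at hlift
      refine hlift (0, f k h _) (0, f k h _) (In_leg (Nat.zero_le _)) (In_leg (Nat.zero_le _)) ?_
      exact Or.inr (Or.inr (Or.inl ⟨rfl, rfl, b, t, by omega, by omega, by omega,
        Or.inr ⟨by dsimp only; omega, by dsimp only; omega⟩⟩))
  · -- crosscaps
    obtain ⟨b, rfl⟩ : ∃ b, i = b + 1 := ⟨i - 1, by have := Finset.mem_Icc.1 hi; omega⟩
    have hi := Finset.mem_Icc.1 hi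
    obtain ⟨t, rfl⟩ : ∃ t, j = t + 1 := ⟨j - 1, by have := Finset.mem_Icc.1 hj; omega⟩
    have hj := Finset.mem_Icc.1 hj
    have e : 4 * k * (b + 1 - 1) = 4 * (k * b) := by rw [Nat.add_sub_cancel]; ring
    have e2 := Nat.mul_le_mul_left k (show b + 1 ≤ h + c + 4 by omega)
    have e3 : k * (b + 1) = k * b + k := by ring
    rw [e] at H1 H2
    rw [z1, z2, col_val H1 (by omega) (by omega), col_val H2 (by omega) (by omega),
      show 4 * (k * b) + (t + 1) - 1 = 4 * (k * b) + t by omega,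
      show 4 * (k * b) + 2 * k + (t + 1) - 1 = 4 * (k * b) + (2 * k + t) by omega] at hlift
    have hb : b = h + 1 ∨ b = h + 2 ∨ b = h + 3 ∨ h + 4 ≤ b := by omega
    rcases hb with rfl | rfl | rfl | hb
    · have e4 : k * (h + 1) = k * h + k := by ring
      have o := own_cases k (4 * k + t)
      have a := arc_cases k (4 * k + t)
      have f2 := f_special k h (2 * k + t) (by omega)
      have g2 : gS k (2 * k + t) = 112 * k + t := by unfold gS; split_ifs <;> omega
      have i1 := In_R (k := k) (h := h) (w := 4 * k + t) (by omega)
      rw [show oc k h (4 * k + t) = 4 * (k * (h + 1)) + t by unfold oc; omega] at i1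
      rw [show 4 * (k * (h + 1)) + (2 * k + t) = 4 * (k * h) + 4 * k + (2 * k + t) by omega] at hlift
      refine hlift _ (0, f k h _) i1 (In_leg (Nat.zero_le _)) ?_
      rw [f2]
      exact NE_C (by omega) (by omega) (by omega)
    · have e4 : k * (h + 2) = k * h + 2 * k := by ring
      have o := own_cases k (8 * k + t)
      have a := arc_cases k (8 * k + t)
      have f2 := f_special k h (6 * k + t) (by omega)
      have g2 : gS k (6 * k + t) = 116 * k + t := by unfold gS; split_ifs <;> omega
      have i1 := In_R (k := k) (h := h) (w := 8 * k + t) (by omega)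
      rw [show oc k h (8 * k + t) = 4 * (k * (h + 2)) + t by unfold oc; omega] at i1
      rw [show 4 * (k * (h + 2)) + (2 * k + t) = 4 * (k * h) + 4 * k + (6 * k + t) by omega] at hlift
      refine hlift _ (0, f k h _) i1 (In_leg (Nat.zero_le _)) ?_
      rw [f2]
      exact NE_C (by omega) (by omega) (by omega)
    · have e4 : k * (h + 3) = k * h + 3 * k := by ring
      have o := own_cases k (14 * k - 1 - t)
      have a := arc_cases k (14 * k - 1 - t)
      have f2 := f_special k h (10 * k + t) (by omega)
      have g2 : gS k (10 * k + t) = 120 * k + t := by unfold gS; split_ifs <;> omega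
      have i1 := In_L (k := k) (h := h) (w := 14 * k - 1 - t) (by omega)
      rw [show oc k h (14 * k - 1 - t) = 4 * (k * (h + 3)) + t by unfold oc; omega] at i1
      rw [show 4 * (k * (h + 3)) + (2 * k + t) = 4 * (k * h) + 4 * k + (10 * k + t) by omega] at hlift
      refine hlift _ (0, f k h _) i1 (In_leg (Nat.zero_le _)) ?_
      rw [f2]
      exact NE_C (by omega) (by omega) (by omega)
    · obtain ⟨d, rfl⟩ : ∃ d, b = d + 1 := ⟨b - 1, by omega⟩
      have e4 : k * (d + 1) = k * d + k := by ring
      have f1 := f_cross k h (d + 1) t (by omega) (by omega)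
      have f2 := f_cross k h (d + 1) (2 * k + t) (by omega) (by omega)
      have g1 : gC k t = t := by unfold gC; rw [if_pos (by omega)]
      have g2 : gC k (2 * k + t) = 36 * k + t := by unfold gC; split_ifs <;> omega
      refine hlift (0, f k h _) (0, f k h _) (In_leg (Nat.zero_le _)) (In_leg (Nat.zero_le _)) ?_
      exact Or.inr (Or.inr (Or.inr ⟨rfl, rfl, d, t, by omega, by omega, by omega,
        by dsimp only; omega, by dsimp only; omega⟩))

/-- The main construction. -/
lemma main (k h c : ℕ) (hk : 1 ≤ k) :
    IsMinorOf (mixedGrid k (h + c + 4) (Finset.Icc 2 (h + 1)) (Finset.Icc (h + 2) (h + c + 4)))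
      (Big k h c (h + c + 3)) := by
  haveI : NeZero (4 * (h + c + 4) * k) := ⟨by positivity⟩
  refine ⟨X k h (h + c + 4) (h + c + 3), ?_, X_connected hk, ?_⟩
  · intro u v huv
    rw [Set.disjoint_left]
    intro p hp hq
    apply huv
    obtain ⟨e1, e2⟩ := In_unique k h _ _ _ _ _ _ hk hp hq
    have e3 := ZMod.val_injective _ e2
    exact Prod.ext (Fin.ext e1) (sub_left_injective e3)
  · intro u v huv
    unfold mixedGrid at huv
    rw [SimpleGraph.fromRel_adj] at huv
    rcases huv.2 with H | H
    · exact edge_rel hk u v H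
    · obtain ⟨a, ha, b, hb, hab⟩ := edge_rel hk v u H
      exact ⟨b, hb, a, ha, hab.symm⟩

lemma main' (k h c m n : ℕ) (hk : 1 ≤ k) (hm : m = h + c + 4) (hn : n = h + c + 3) :
    IsMinorOf (mixedGrid k m (Finset.Icc 2 (h + 1)) (Finset.Icc (h + 2) m))
      (mixedGrid (18 * k) n (Finset.Icc 2 (h + 2)) (Finset.Icc (h + 3) n)) := by
  subst hm hn
  exact main k h c hk

end DyckTrade

/-- For all integers `k ≥ 1`, `h ≥ 0` and `c ≥ 3`, the Dyck grid
`D_{18k}^{(h+1,c−2)}` contains the Dyck grid `D_k^{(h,c)}` as a minor. -/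
theorem dyckGrid_trade_handle_for_crosscaps (k h c : ℕ) (hk : 1 ≤ k) (hc : 3 ≤ c) :
    IsMinorOf (dyckGrid k h c) (dyckGrid (18 * k) (h + 1) (c - 2)) := by
  exact DyckTrade.main' k h (c - 3) (h + c + 1) (h + 1 + (c - 2) + 1) hk (by omega) (by omega)
end

section
/- Let g > 0 and let h, c, h', c' ≥ 0 be integers with c > 0, c' > 0 and 2h + c = 2h' + c' = g. Then for every integer k ≥ 1, every partition {I_hdl, I_crscp} of [2, h+c+1] with |I_hdl| = h, |I_crscp| = c, and every partition {I'_hdl, I'_crscp} of [2, h'+c'+1] with |I'_hdl| = h', |I'_crscp| = c', the mixed surface grid H^{162^{4g}·k}_{I_hdl,I_crscp} of order 162^{4g}·k with h handles and c crosscaps contains the mixed surface grid H^k_{I'_hdl,I'_crscp} of order k with h' handles and c' crosscaps as a minor. -/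
open SimpleGraph

section Minors

theorem induce_connected_of_rank {β : Type*} (G : SimpleGraph β) (S : Set β) (r : β) (hr : r ∈ S)
    (rk : β → ℕ) (h : ∀ v ∈ S, v = r ∨ ∃ u ∈ S, G.Adj v u ∧ rk u < rk v) :
    (G.induce S).Connected := by
  have key : ∀ n : ℕ, ∀ v (hv : v ∈ S), rk v = n →
      (G.induce S).Reachable ⟨v, hv⟩ ⟨r, hr⟩ := by
    intro n
    induction n using Nat.strong_induction_on with
    | _ n ih =>
      intro v hv hn
      rcases h v hv with rfl | ⟨u, hu, hadj, hlt⟩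
      · exact SimpleGraph.Reachable.refl _
      · have h1 : (G.induce S).Adj ⟨v, hv⟩ ⟨u, hu⟩ := hadj
        exact h1.reachable.trans (ih (rk u) (hn ▸ hlt) u hu rfl)
  have : Nonempty S := ⟨⟨r, hr⟩⟩
  exact ⟨fun a b => (key _ a.1 a.2 rfl).trans (key _ b.1 b.2 rfl).symm⟩

theorem IsMinorOf.trans {α β γ : Type*} {F : SimpleGraph α} {G : SimpleGraph β}
    {H : SimpleGraph γ} (h1 : IsMinorOf F G) (h2 : IsMinorOf G H) : IsMinorOf F H := by
  obtain ⟨X, Xd, Xc, Xe⟩ := h1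
  obtain ⟨Y, Yd, Yc, Ye⟩ := h2
  refine ⟨fun a => {c | ∃ b ∈ X a, c ∈ Y b}, ?_, ?_, ?_⟩
  · intro u v huv
    rw [Set.disjoint_left]
    rintro c ⟨b, hb, hc⟩ ⟨b', hb', hc'⟩
    by_cases hbb : b = b'
    · subst hbb
      exact Set.disjoint_left.mp (Xd u v huv) hb hb'
    · exact Set.disjoint_left.mp (Yd b b' hbb) hc hc'
  · intro v
    set S : Set γ := {c | ∃ b ∈ X v, c ∈ Y b} with hS
    have inner : ∀ b (_ : b ∈ X v) c (hc : c ∈ S) c' (hc' : c' ∈ S), c ∈ Y b → c' ∈ Y b →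
        (H.induce S).Reachable ⟨c, hc⟩ ⟨c', hc'⟩ := by
      intro b hb c hc c' hc' h h'
      have hsub : Y b ⊆ S := fun z hz => ⟨b, hb, hz⟩
      have := (Yc b).preconnected ⟨c, h⟩ ⟨c', h'⟩
      exact this.map (SimpleGraph.induceHomOfLE H hsub).toHom
    have outer : ∀ b b' : X v, (G.induce (X v)).Reachable b b' →
        ∀ c (hc : c ∈ S) c' (hc' : c' ∈ S), c ∈ Y b.1 → c' ∈ Y b'.1 →
        (H.induce S).Reachable ⟨c, hc⟩ ⟨c', hc'⟩ := by
      rintro b b' ⟨w⟩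
      induction w with
      | nil => intro c hc c' hc' h h'; exact inner _ (Subtype.mem _) c hc c' hc' h h'
      | @cons a b d hab w ih =>
        intro c hc c' hc' h h'
        have hab' : G.Adj a.1 b.1 := hab
        obtain ⟨x, hx, y, hy, hxy⟩ := Ye _ _ hab'
        have hxS : x ∈ S := ⟨a.1, a.2, hx⟩
        have hyS : y ∈ S := ⟨b.1, b.2, hy⟩
        have e : (H.induce S).Adj ⟨x, hxS⟩ ⟨y, hyS⟩ := hxy
        exact ((inner _ a.2 c hc x hxS h hx).trans e.reachable).trans (ih y hyS c' hc' hy h')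
    obtain ⟨b0⟩ := (Xc v).nonempty
    obtain ⟨c0⟩ := (Yc b0.1).nonempty
    have : Nonempty S := ⟨⟨c0.1, b0.1, b0.2, c0.2⟩⟩
    refine ⟨?_⟩
    rintro ⟨c, b, hb, hc⟩ ⟨c', b', hb', hc'⟩
    exact outer ⟨b, hb⟩ ⟨b', hb'⟩ ((Xc v).preconnected _ _) c _ c' _ hc hc'
  · intro u v huv
    obtain ⟨a, ha, b, hb, hab⟩ := Xe u v huv
    obtain ⟨x, hx, y, hy, hxy⟩ := Ye a b hab
    exact ⟨x, ⟨a, ha, hx⟩, y, ⟨b, hb, hy⟩, hxy⟩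

theorem IsMinorOf.of_hom {α β : Type*} {F : SimpleGraph α} {G : SimpleGraph β} (f : α → β)
    (hf : Function.Injective f) (h : ∀ u v, F.Adj u v → G.Adj (f u) (f v)) : IsMinorOf F G := by
  refine ⟨fun a => {f a}, ?_, ?_, ?_⟩
  · intro u v huv
    simpa using fun h => huv (hf h)
  · intro v
    exact induce_connected_of_rank G _ (f v) rfl (fun _ => 0) (fun w hw => Or.inl hw)
  · intro u v huv
    exact ⟨_, rfl, _, rfl, h u v huv⟩

/-- A minor model between graphs given by `fromRel`. -/
theorem IsMinorOf.of_rel {α β : Type*} (r : α → α → Prop) (s : β → β → Prop) (X : α → Set β)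
    (hd : ∀ u v x, x ∈ X u → x ∈ X v → u = v)
    (hc : ∀ v, ((SimpleGraph.fromRel s).induce (X v)).Connected)
    (he : ∀ u v, u ≠ v → r u v → ∃ a ∈ X u, ∃ b ∈ X v, s a b ∨ s b a) :
    IsMinorOf (SimpleGraph.fromRel r) (SimpleGraph.fromRel s) := by
  have hd' : ∀ u v : α, u ≠ v → Disjoint (X u) (X v) := by
    intro u v huv
    rw [Set.disjoint_left]
    intro x hx hy
    exact huv (hd u v x hx hy)
  refine ⟨X, hd', hc, ?_⟩
  intro u v huv
  rw [SimpleGraph.fromRel_adj] at huv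
  obtain ⟨hne, h | h⟩ := huv
  · obtain ⟨a, ha, b, hb, hab⟩ := he u v hne h
    refine ⟨a, ha, b, hb, ?_⟩
    rw [SimpleGraph.fromRel_adj]
    refine ⟨?_, hab⟩
    rintro rfl
    exact hne (hd u v a ha hb)
  · obtain ⟨a, ha, b, hb, hab⟩ := he v u hne.symm h
    refine ⟨b, hb, a, ha, ?_⟩
    rw [SimpleGraph.fromRel_adj]
    refine ⟨?_, hab.symm⟩
    rintro rfl
    exact hne (hd u v b hb ha)

end Minors

section ChordGraph

/-- The relation generating the cylinder with `m` rows, `N` columns and chords `M` in row `0`. -/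
def cgRel (m N : ℕ) (M : ℕ → ℕ → Prop) (p q : Fin m × Fin N) : Prop :=
  (p.1.1 = q.1.1 ∧ (q.2.1 = p.2.1 + 1 ∨ (p.2.1 + 1 = N ∧ q.2.1 = 0))) ∨
  (p.2.1 = q.2.1 ∧ q.1.1 = p.1.1 + 1) ∨
  (p.1.1 = 0 ∧ q.1.1 = 0 ∧ M p.2.1 q.2.1)

/-- The cylinder with `m` rows, `N` columns and chords `M` in row `0`. -/
def cg (m N : ℕ) (M : ℕ → ℕ → Prop) : SimpleGraph (Fin m × Fin N) :=
  SimpleGraph.fromRel (cgRel m N M)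

theorem cg_mono {m m' N N' : ℕ} {M M' : ℕ → ℕ → Prop} (hm : m' ≤ m) (hN : N' = N)
    (hM : ∀ i j, i < N → j < N → i ≠ j → M' i j → M i j) :
    IsMinorOf (cg m' N' M') (cg m N M) := by
  subst hN
  refine IsMinorOf.of_hom (fun p => (⟨p.1.1, by omega⟩, p.2)) ?_ ?_
  · rintro ⟨a, b⟩ ⟨c, d⟩ h
    simp only [Prod.mk.injEq, Fin.mk.injEq] at h ⊢
    exact ⟨Fin.ext h.1, h.2⟩
  · rintro ⟨a, b⟩ ⟨c, d⟩ h
    unfold cg at h ⊢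
    rw [SimpleGraph.fromRel_adj] at h ⊢
    simp only [cgRel, ne_eq, Prod.mk.injEq, Fin.ext_iff] at h ⊢
    obtain ⟨hne, h⟩ := h
    refine ⟨hne, ?_⟩
    have hb := b.2
    have hd := d.2
    rcases h with (h | h | h) | (h | h | h)
    · exact Or.inl (Or.inl h)
    · exact Or.inl (Or.inr (Or.inl h))
    · refine Or.inl (Or.inr (Or.inr ⟨h.1, h.2.1, hM _ _ hb hd ?_ h.2.2⟩))
      intro hh; apply hne; omega
    · exact Or.inr (Or.inl h)
    · exact Or.inr (Or.inr (Or.inl h))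
    · refine Or.inr (Or.inr (Or.inr ⟨h.1, h.2.1, hM _ _ hd hb ?_ h.2.2⟩))
      intro hh; apply hne; omega

/-- Deleting column `p` (contracting it into its left neighbour). -/
theorem cg_delete {m N p : ℕ} {M : ℕ → ℕ → Prop} (hp : 1 ≤ p) (hpN : p ≤ N) :
    IsMinorOf (cg m N (fun i j => M (if i < p then i else i + 1) (if j < p then j else j + 1)))
      (cg m (N + 1) M) := by
  refine IsMinorOf.of_rel _ _ (fun v => {w | w.1.1 = v.1.1 ∧
    (w.2.1 = (if v.2.1 < p then v.2.1 else v.2.1 + 1) ∨ (v.2.1 + 1 = p ∧ w.2.1 = p))}) ?_ ?_ ?_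
  · rintro ⟨a, b⟩ ⟨c, d⟩ ⟨e, f⟩ h1 h2
    simp only [Set.mem_ofPred_eq, Prod.mk.injEq, Fin.ext_iff] at h1 h2 ⊢
    split_ifs at h1 h2 <;> omega
  · rintro ⟨a, b⟩
    have hb := b.2
    refine induce_connected_of_rank _ _ (a, ⟨if b.1 < p then b.1 else b.1 + 1, by split_ifs <;> omega⟩)
      (by simp) (fun w => if w.2.1 = p then 1 else 0) ?_
    rintro ⟨c, d⟩ ⟨h1, h2⟩
    simp only at h1 h2
    have h1 : c = a := Fin.ext h1
    subst h1
    rcases h2 with h2 | h2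
    · left
      ext
      · rfl
      · exact h2
    · right
      refine ⟨(c, ⟨if b.1 < p then b.1 else b.1 + 1, by split_ifs <;> omega⟩), by simp, ?_, ?_⟩
      · rw [SimpleGraph.fromRel_adj]
        refine ⟨fun hh => ?_, Or.inr (Or.inl ⟨rfl, Or.inl ?_⟩)⟩
        · have := congrArg (fun z => z.2.1) hh
          simp only at this
          split_ifs at this <;> omega
        · simp only
          split_ifs <;> omega
      · simp only
        split_ifs <;> omega
  · rintro ⟨a, b⟩ ⟨c, d⟩ hne h
    have hb := b.2
    have hd := d.2
    rcases h with ⟨h1, h2⟩ | ⟨h1, h2⟩ | ⟨h1, h2, h3⟩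
    · simp only at h1 h2
      by_cases hbp : b.1 + 1 = p
      · refine ⟨(a, ⟨p, by omega⟩), ⟨rfl, Or.inr ⟨hbp, rfl⟩⟩,
          (c, ⟨if d.1 < p then d.1 else d.1 + 1, by split_ifs <;> omega⟩), ⟨rfl, Or.inl rfl⟩,
          Or.inl (Or.inl ⟨h1, ?_⟩)⟩
        simp only
        split_ifs <;> omega
      · refine ⟨(a, ⟨if b.1 < p then b.1 else b.1 + 1, by split_ifs <;> omega⟩), ⟨rfl, Or.inl rfl⟩,
          (c, ⟨if d.1 < p then d.1 else d.1 + 1, by split_ifs <;> omega⟩), ⟨rfl, Or.inl rfl⟩,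
          Or.inl (Or.inl ⟨h1, ?_⟩)⟩
        simp only
        split_ifs <;> omega
    · simp only at h1 h2
      refine ⟨(a, ⟨if b.1 < p then b.1 else b.1 + 1, by split_ifs <;> omega⟩), ⟨rfl, Or.inl rfl⟩,
          (c, ⟨if d.1 < p then d.1 else d.1 + 1, by split_ifs <;> omega⟩), ⟨rfl, Or.inl rfl⟩,
          Or.inl (Or.inr (Or.inl ⟨?_, h2⟩))⟩
      simp only
      split_ifs <;> omega
    · refine ⟨(a, ⟨if b.1 < p then b.1 else b.1 + 1, by split_ifs <;> omega⟩), ⟨rfl, Or.inl rfl⟩,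
          (c, ⟨if d.1 < p then d.1 else d.1 + 1, by split_ifs <;> omega⟩), ⟨rfl, Or.inl rfl⟩,
          Or.inl (Or.inr (Or.inr ⟨h1, h2, h3⟩))⟩

/-- Contracting row `0` into row `1`, except in columns `p` and `p + 1`, whose top vertices are
used as a link attached to the unique other column `e` (if any) joined to `p`. -/
theorem cg_link {m N p : ℕ} {M : ℕ → ℕ → Prop} (hpN : p + 1 < N) (E : ℕ → Prop)
    (hE : ∀ i, E i → i ≠ p ∧ i ≠ p + 1 ∧ M i p)
    (hEu : ∀ i j, i < N → j < N → E i → E j → i = j) :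
    IsMinorOf (cg m N (fun i j => i ≠ p ∧ i ≠ p + 1 ∧ j ≠ p ∧ j ≠ p + 1 ∧
        (M i j ∨ (E i ∧ M (p + 1) j) ∨ (E j ∧ M (p + 1) i))))
      (cg (m + 1) N M) := by
  refine IsMinorOf.of_rel _ _ (fun v => {w |
    (w.1.1 = v.1.1 + 1 ∧ w.2.1 = v.2.1) ∨
    (v.1.1 = 0 ∧ w.1.1 = 0 ∧ w.2.1 = v.2.1 ∧ v.2.1 ≠ p ∧ v.2.1 ≠ p + 1) ∨
    (v.1.1 = 0 ∧ w.1.1 = 0 ∧ E v.2.1 ∧ (w.2.1 = p ∨ w.2.1 = p + 1))}) ?_ ?_ ?_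
  · rintro ⟨a, b⟩ ⟨c, d⟩ ⟨e, f⟩ h1 h2
    simp only [Set.mem_ofPred_eq, Prod.mk.injEq, Fin.ext_iff] at h1 h2 ⊢
    rcases h1 with h1 | h1 | h1 <;> rcases h2 with h2 | h2 | h2 <;> try omega
    exact ⟨by omega, hEu _ _ b.2 d.2 h1.2.2.1 h2.2.2.1⟩
  · rintro ⟨a, b⟩
    have hb := b.2
    have ha := a.2
    refine induce_connected_of_rank _ _ (⟨a.1 + 1, by omega⟩, b)
      (Or.inl ⟨rfl, rfl⟩)
      (fun w => if w.1.1 = 0 then (if w.2.1 = p then 2 else if w.2.1 = p + 1 then 3 else 1) else 0) ?_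
    rintro ⟨c, d⟩ h
    simp only [Set.mem_ofPred_eq] at h
    rcases h with ⟨h1, h2⟩ | ⟨h1, h2, h3, h4, h5⟩ | ⟨h1, h2, h3, h4⟩
    · left
      ext
      · exact h1
      · exact h2
    · right
      refine ⟨(⟨a.1 + 1, by omega⟩, b), Or.inl ⟨rfl, rfl⟩, ?_, ?_⟩
      · rw [SimpleGraph.fromRel_adj]
        simp only [cgRel, ne_eq, Prod.mk.injEq, Fin.ext_iff]
        refine ⟨by omega, Or.inl (Or.inr (Or.inl ⟨by omega, by omega⟩))⟩
      · simp only
        rw [if_neg (by omega), if_pos (by omega)]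
        split_ifs <;> omega
    · right
      obtain ⟨e1, e2, e3⟩ := hE _ h3
      rcases h4 with h4 | h4
      · refine ⟨(⟨0, by omega⟩, b), Or.inr (Or.inl ⟨h1, rfl, rfl, e1, e2⟩), ?_, ?_⟩
        · rw [SimpleGraph.fromRel_adj]
          refine ⟨fun hh => ?_, Or.inr (Or.inr (Or.inr ⟨rfl, h2, ?_⟩))⟩
          · have := congrArg (fun z => z.2.1) hh
            simp only at this
            omega
          · simp only
            rw [h4]; exact e3
        · simp only
          split_ifs <;> omega
      · refine ⟨(⟨0, by omega⟩, ⟨p, by omega⟩), Or.inr (Or.inr ⟨h1, rfl, h3, Or.inl rfl⟩), ?_, ?_⟩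
        · rw [SimpleGraph.fromRel_adj]
          refine ⟨fun hh => ?_, Or.inr (Or.inl ⟨h2.symm, Or.inl h4⟩)⟩
          have := congrArg (fun z => z.2.1) hh
          simp only at this
          omega
        · simp only
          split_ifs <;> omega
  · rintro ⟨a, b⟩ ⟨c, d⟩ hne h
    have hb := b.2
    have hd := d.2
    have ha := a.2
    have hc := c.2
    rcases h with ⟨h1, h2⟩ | ⟨h1, h2⟩ | ⟨h1, h2, h3, h4, h5, h6, h7⟩
    · simp only at h1 h2
      exact ⟨(⟨a.1 + 1, by omega⟩, b), Or.inl ⟨rfl, rfl⟩, (⟨c.1 + 1, by omega⟩, d),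
        Or.inl ⟨rfl, rfl⟩, Or.inl (Or.inl ⟨by simp only; omega, by simp only; omega⟩)⟩
    · simp only at h1 h2
      exact ⟨(⟨a.1 + 1, by omega⟩, b), Or.inl ⟨rfl, rfl⟩, (⟨c.1 + 1, by omega⟩, d),
        Or.inl ⟨rfl, rfl⟩, Or.inl (Or.inr (Or.inl ⟨by simp only; omega, by simp only; omega⟩))⟩
    · simp only at h1 h2 h3 h4 h5 h6 h7
      have mb : ((⟨0, by omega⟩, b) : Fin (m + 1) × Fin N) ∈ {w : Fin (m + 1) × Fin N |
          (w.1.1 = a.1 + 1 ∧ w.2.1 = b.1) ∨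
          (a.1 = 0 ∧ w.1.1 = 0 ∧ w.2.1 = b.1 ∧ b.1 ≠ p ∧ b.1 ≠ p + 1) ∨
          (a.1 = 0 ∧ w.1.1 = 0 ∧ E b.1 ∧ (w.2.1 = p ∨ w.2.1 = p + 1))} :=
        Or.inr (Or.inl ⟨h1, rfl, rfl, h3, h4⟩)
      have md : ((⟨0, by omega⟩, d) : Fin (m + 1) × Fin N) ∈ {w : Fin (m + 1) × Fin N |
          (w.1.1 = c.1 + 1 ∧ w.2.1 = d.1) ∨
          (c.1 = 0 ∧ w.1.1 = 0 ∧ w.2.1 = d.1 ∧ d.1 ≠ p ∧ d.1 ≠ p + 1) ∨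
          (c.1 = 0 ∧ w.1.1 = 0 ∧ E d.1 ∧ (w.2.1 = p ∨ w.2.1 = p + 1))} :=
        Or.inr (Or.inl ⟨h2, rfl, rfl, h5, h6⟩)
      rcases h7 with h7 | ⟨h7, h8⟩ | ⟨h7, h8⟩
      · exact ⟨_, mb, _, md, Or.inl (Or.inr (Or.inr ⟨rfl, rfl, h7⟩))⟩
      · refine ⟨(⟨0, by omega⟩, ⟨p + 1, by omega⟩), Or.inr (Or.inr ⟨h1, rfl, h7, Or.inr rfl⟩),
          _, md, Or.inl (Or.inr (Or.inr ⟨rfl, rfl, h8⟩))⟩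
      · refine ⟨_, mb, (⟨0, by omega⟩, ⟨p + 1, by omega⟩), Or.inr (Or.inr ⟨h2, rfl, h7, Or.inr rfl⟩),
          Or.inr (Or.inr (Or.inr ⟨rfl, rfl, h8⟩))⟩

end ChordGraph

section WordGraph

variable {α : Type*}

/-- The cylinder whose chords join the columns carrying equal letters. -/
def lg (m : ℕ) (L : List α) : SimpleGraph (Fin m × Fin L.length) :=
  cg m L.length (fun i j => L[i]? = L[j]?)

theorem lg_rows {m m' : ℕ} (h : m' ≤ m) (L : List α) : IsMinorOf (lg m' L) (lg m L) :=
  cg_mono h rfl (fun _ _ _ _ _ h => h)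

theorem lg_unmap {β : Type*} (m : ℕ) (L : List α) (f : α → β) :
    IsMinorOf (lg m L) (lg m (L.map f)) := by
  refine cg_mono le_rfl (by simp) ?_
  intro i j _ _ _ h
  simp only [List.getElem?_map]
  rw [h]

theorem getElem?_skip_one (A B : List α) (x : α) (i : ℕ) :
    (A ++ x :: B)[if i < A.length then i else i + 1]? = (A ++ B)[i]? := by
  split_ifs with h
  · rw [List.getElem?_append_left h, List.getElem?_append_left h]
  · rw [List.getElem?_append_right (by omega), List.getElem?_append_right (by omega)]
    rw [show i + 1 - A.length = (i - A.length) + 1 by omega, List.getElem?_cons_succ]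

theorem lg_delete (m : ℕ) (A B : List α) (x : α) (hA : A ≠ []) :
    IsMinorOf (lg m (A ++ B)) (lg m (A ++ x :: B)) := by
  have hA' : 1 ≤ A.length := List.length_pos_of_ne_nil hA
  have h1 := cg_delete (m := m) (N := (A ++ B).length) (p := A.length)
    (M := fun i j => (A ++ x :: B)[i]? = (A ++ x :: B)[j]?) hA' (by simp)
  refine IsMinorOf.trans ?_ (h1.trans ?_)
  · refine cg_mono le_rfl rfl ?_
    intro i j _ _ _ h
    simp only [getElem?_skip_one]
    exact h
  · exact cg_mono le_rfl (by simp; omega) (fun _ _ _ _ _ h => h)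

theorem lg_sublist_aux (m : ℕ) {L' L : List α} (h : L'.Sublist L) :
    ∀ A : List α, A ≠ [] → IsMinorOf (lg m (A ++ L')) (lg m (A ++ L)) := by
  induction h with
  | slnil => intro A _; exact lg_rows le_rfl _
  | @cons l1 l2 a h ih => intro A hA; exact (ih A hA).trans (lg_delete m A _ a hA)
  | @cons_cons l1 l2 a h ih =>
    intro A hA
    have := ih (A ++ [a]) (by simp)
    rw [List.append_assoc, List.append_assoc] at this
    exact this

theorem lg_sublist (m : ℕ) {L' L : List α} (h : L'.Sublist L) (hne : L' ≠ [])
    (hh : L'.head? = L.head?) : IsMinorOf (lg m L') (lg m L) := by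
  cases L' with
  | nil => exact absurd rfl hne
  | cons a T' =>
    cases L with
    | nil => simp at hh
    | cons b T =>
      simp only [List.head?_cons, Option.some.injEq] at hh
      subst hh
      rw [List.cons_sublist_cons] at h
      simpa using lg_sublist_aux m h [a] (by simp)

theorem count_le_one_unique [DecidableEq α] {L : List α} {x : α} (h : L.count x ≤ 1) {i j : ℕ}
    (hi : L[i]? = some x) (hj : L[j]? = some x) : i = j := by
  induction L generalizing i j with
  | nil => simp at hi
  | cons a T ih =>
    have hmem : ∀ n : ℕ, T[n]? = some x → 1 ≤ T.count x := fun n hn =>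
      List.one_le_count_iff.mpr (List.mem_of_getElem? hn)
    rw [List.count_cons] at h
    cases i with
    | zero =>
      cases j with
      | zero => rfl
      | succ j =>
        simp only [List.getElem?_cons_zero, Option.some.injEq, List.getElem?_cons_succ] at hi hj
        have := hmem j hj
        simp [hi] at h
        omega
    | succ i =>
      cases j with
      | zero =>
        simp only [List.getElem?_cons_zero, Option.some.injEq, List.getElem?_cons_succ] at hi hj
        have := hmem i hi
        simp [hj] at h
        omega
      | succ j =>
        simp only [List.getElem?_cons_succ] at hi hj
        rw [ih (by omega) hi hj]

theorem getElem?_skip_two (A B : List α) (x y : α) (i : ℕ) :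
    (A ++ x :: y :: B)[if i < A.length then i else i + 2]? = (A ++ B)[i]? := by
  split_ifs with h
  · rw [List.getElem?_append_left h, List.getElem?_append_left h]
  · rw [List.getElem?_append_right (by omega), List.getElem?_append_right (by omega)]
    rw [show i + 2 - A.length = (i - A.length) + 1 + 1 by omega, List.getElem?_cons_succ,
      List.getElem?_cons_succ]

theorem lg_glue [DecidableEq α] (m : ℕ) (A B : List α) (x y : α) (hA : A ≠ [])
    (hc : (A ++ B).count x ≤ 1) :
    IsMinorOf (lg m ((A ++ B).map (fun z => if z = y then x else z)))
      (lg (m + 1) (A ++ x :: y :: B)) := by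
  have hA' : 1 ≤ A.length := List.length_pos_of_ne_nil hA
  set p := A.length with hp
  set L := A ++ x :: y :: B with hL
  have hLl : L.length = p + B.length + 2 := by simp [hL]; omega
  have hLx : L[p]? = some x := by
    rw [hL, List.getElem?_append_right (by omega)]; simp [hp]
  have hLy : L[p + 1]? = some y := by
    rw [hL, List.getElem?_append_right (by omega)]; simp [hp]
  have hs : ∀ i, L[if i < p then i else i + 2]? = (A ++ B)[i]? :=
    fun i => getElem?_skip_two A B x y i
  have hsurj : ∀ i, i ≠ p → i ≠ p + 1 → ∃ i', i = if i' < p then i' else i' + 2 := by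
    intro i h1 h2
    by_cases h : i < p
    · exact ⟨i, by simp [h]⟩
    · exact ⟨i - 2, by rw [if_neg (by omega)]; omega⟩
  have h1 := cg_link (m := m) (N := L.length) (p := p) (M := fun i j => L[i]? = L[j]?)
    (by omega) (fun i => i ≠ p ∧ i ≠ p + 1 ∧ L[i]? = some x)
    (by rintro i ⟨a, b, c⟩; exact ⟨a, b, by rw [c, hLx]⟩)
    (by
      rintro i j _ _ ⟨a, b, c⟩ ⟨a', b', c'⟩
      obtain ⟨i', rfl⟩ := hsurj i a b
      obtain ⟨j', rfl⟩ := hsurj j a' b'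
      rw [hs] at c c'
      rw [count_le_one_unique hc c c'])
  refine IsMinorOf.trans ?_ h1
  set M1 : ℕ → ℕ → Prop := (fun i j => i ≠ p ∧ i ≠ p + 1 ∧ j ≠ p ∧ j ≠ p + 1 ∧
        (L[i]? = L[j]? ∨ ((i ≠ p ∧ i ≠ p + 1 ∧ L[i]? = some x) ∧ L[p + 1]? = L[j]?) ∨
          ((j ≠ p ∧ j ≠ p + 1 ∧ L[j]? = some x) ∧ L[p + 1]? = L[i]?))) with hM1
  have h2 := cg_delete (m := m) (N := p + B.length + 1) (p := p + 1) (M := M1)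
    (by omega) (by omega)
  have h3 := cg_delete (m := m) (N := p + B.length) (p := p)
    (M := fun i j => M1 (if i < p + 1 then i else i + 1) (if j < p + 1 then j else j + 1))
    (by omega) (by omega)
  refine IsMinorOf.trans ?_ (h3.trans (h2.trans (cg_mono le_rfl (by omega)
    (fun _ _ _ _ _ h => h))))
  refine cg_mono le_rfl (by simp [hp]) ?_
  intro i j hi hj hij h
  have comp : ∀ i, (if (if i < p then i else i + 1) < p + 1 then (if i < p then i else i + 1)
      else (if i < p then i else i + 1) + 1) = if i < p then i else i + 2 := by
    intro i
    split_ifs <;> omega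
  simp only [comp]
  have hne : ∀ i, (if i < p then i else i + 2) ≠ p ∧ (if i < p then i else i + 2) ≠ p + 1 := by
    intro i
    split_ifs <;> omega
  rw [hM1]
  simp only [hs, hLy]
  refine ⟨(hne i).1, (hne i).2, (hne j).1, (hne j).2, ?_⟩
  have hi' : i < (A ++ B).length := by simp; omega
  have hj' : j < (A ++ B).length := by simp; omega
  simp only [List.getElem?_map, List.getElem?_eq_getElem hi', List.getElem?_eq_getElem hj',
    Option.map_some, Option.some.injEq] at h ⊢
  have hni := hne i
  have hnj := hne j
  by_cases c1 : (A ++ B)[i] = y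
  · by_cases c2 : (A ++ B)[j] = y
    · left; rw [c1, c2]
    · rw [if_pos c1, if_neg c2] at h
      exact Or.inr (Or.inr ⟨⟨hnj.1, hnj.2, h.symm⟩, c1.symm⟩)
  · by_cases c2 : (A ++ B)[j] = y
    · rw [if_neg c1, if_pos c2] at h
      exact Or.inr (Or.inl ⟨⟨hni.1, hni.2, h⟩, c2.symm⟩)
    · rw [if_neg c1, if_neg c2] at h
      exact Or.inl h

theorem count_map_le_of_fiber [DecidableEq α] (s : α → α) (x : α) (hs : ∀ z, s z = x → z = x)
    (L : List α) : (L.map s).count x ≤ L.count x := by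
  induction L with
  | nil => simp
  | cons a T ih =>
    rw [List.map_cons, List.count_cons, List.count_cons]
    by_cases h : s a = x
    · have := hs a h
      subst this
      rw [h]
      omega
    · simp [h]
      omega

theorem lg_glueMany [DecidableEq α] (Q : List α) : ∀ (m : ℕ) (P A B : List α) (f : α → α),
    A ≠ [] → Q.map f = P.reverse → (∀ z, z ∉ Q → f z = z) → Q.Nodup → P.Nodup →
    (∀ z ∈ P, z ∉ Q) → (∀ z ∈ P, (A ++ B).count z ≤ 1) →
    IsMinorOf (lg m ((A ++ B).map f)) (lg (m + Q.length) (A ++ P ++ Q ++ B)) := by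
  induction Q with
  | nil =>
    intro m P A B f hA hPQ hf _ _ _ _
    have hP : P = [] := by simpa using hPQ.symm
    have : f = id := by funext z; exact hf z (by simp)
    subst hP this
    have e : A ++ [] ++ [] ++ B = A ++ B := by simp
    rw [List.map_id, e]
    exact lg_rows le_rfl _
  | cons y Q ih =>
    intro m P A B f hA hPQ hf hQ hP hd hc
    obtain ⟨P, x, rfl⟩ : ∃ P' x, P = P' ++ [x] := by
      rcases List.eq_nil_or_concat P with rfl | ⟨P', x, h⟩
      · simp at hPQ
      · exact ⟨P', x, by simpa using h⟩
    simp only [List.map_cons, List.reverse_append, List.reverse_cons, List.reverse_nil,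
      List.nil_append, List.singleton_append, List.cons.injEq] at hPQ
    obtain ⟨hy, hPQ⟩ := hPQ
    rw [List.nodup_cons] at hQ
    have hPn : P.Nodup := hP.of_append_left
    have hxP : x ∉ P := by
      intro hx
      exact (List.disjoint_of_nodup_append hP) hx (by simp)
    have hxQ := hd x (by simp)
    have hxy : x ≠ y := fun h => hxQ (by simp [h])
    have hxQ' : x ∉ Q := fun h => hxQ (by simp [h])
    have hPy : ∀ z ∈ P, z ≠ y := fun z hz h => hd z (by simp [hz]) (by simp [h])
    have hPQ' : ∀ z ∈ P, z ∉ Q := fun z hz h => hd z (by simp [hz]) (by simp [h])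
    have g1 := lg_glue (m + Q.length) (A ++ P) (Q ++ B) x y (by simp [hA]) (by
      have := hc x (by simp)
      simp only [List.count_append] at this ⊢
      rw [List.count_eq_zero.mpr hxP, List.count_eq_zero.mpr hxQ']
      omega)
    set s : α → α := fun z => if z = y then x else z with hs
    have hsP : P.map s = P := by
      rw [List.map_congr_left (g := id)]
      · simp
      · intro z hz; simp [hs, hPy z hz]
    have hsQ : Q.map s = Q := by
      rw [List.map_congr_left (g := id)]
      · simp
      · intro z hz
        have : z ≠ y := fun h => hQ.1 (h ▸ hz)
        simp [hs, this]
    have g2 := ih m P (A.map s) (B.map s) (fun z => if z = y then y else f z) (by simp [hA])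
      (by
        rw [← hPQ]
        apply List.map_congr_left
        intro z hz
        have : z ≠ y := fun h => hQ.1 (h ▸ hz)
        simp [this])
      (by
        intro z hz
        by_cases h : z = y
        · simp [h]
        · simp only [h, if_false]
          exact hf z (by simp [h, hz]))
      hQ.2 hPn hPQ'
      (by
        intro z hz
        rw [← List.map_append]
        refine le_trans (count_map_le_of_fiber s z ?_ _) (hc z (by simp [hz]))
        intro w hw
        simp only [hs] at hw
        split_ifs at hw with h
        · exact absurd (hw ▸ hz) hxP
        · exact hw)
    have e1 : (A.map s ++ B.map s).map (fun z => if z = y then y else f z) = (A ++ B).map f := by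
      rw [← List.map_append, List.map_map]
      apply List.map_congr_left
      intro z _
      simp only [Function.comp, hs]
      by_cases h : z = y
      · simp only [h, if_true, hxy, if_false]
        rw [hf x hxQ, hy]
      · simp [h]
    rw [e1] at g2
    have e2 : ((A ++ P) ++ (Q ++ B)).map s = A.map s ++ P ++ Q ++ B.map s := by
      simp [hsP, hsQ]
    rw [e2] at g1
    refine g2.trans ?_
    have e3 : A ++ (P ++ [x]) ++ (y :: Q) ++ B = A ++ P ++ x :: y :: (Q ++ B) := by simp
    rw [e3]
    exact g1

end WordGraph

section Bundles

/-- The letters of a bundle of width `k`. -/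
def ex1 (k : ℕ) (x : ℕ × Bool) : List (ℕ × ℕ) :=
  (List.range k).map (fun j => (x.1, if x.2 then j else k - 1 - j))

/-- Expansion of a signed word into bundles of width `k`. -/
def expand (k : ℕ) (w : List (ℕ × Bool)) : List (ℕ × ℕ) := w.flatMap (ex1 k)

/-- Action of a signed relabelling on signed letters. -/
def act (f : ℕ → ℕ × Bool) (x : ℕ × Bool) : ℕ × Bool := ((f x.1).1, (f x.1).2 == x.2)

/-- Action of a signed relabelling on the letters of bundles. -/
def actL (k : ℕ) (f : ℕ → ℕ × Bool) (x : ℕ × ℕ) : ℕ × ℕ :=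
  ((f x.1).1, if (f x.1).2 then x.2 else k - 1 - x.2)

theorem expand_append (k : ℕ) (A B : List (ℕ × Bool)) :
    expand k (A ++ B) = expand k A ++ expand k B := by
  simp [expand]

theorem ex1_act (k : ℕ) (f : ℕ → ℕ × Bool) (x : ℕ × Bool) :
    ex1 k (act f x) = (ex1 k x).map (actL k f) := by
  unfold ex1 act actL
  rw [List.map_map]
  apply List.map_congr_left
  intro j hj
  rw [List.mem_range] at hj
  simp only [Function.comp]
  cases (f x.1).2 <;> cases x.2 <;> simp
  omega

theorem expand_act (k : ℕ) (f : ℕ → ℕ × Bool) (w : List (ℕ × Bool)) :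
    expand k (w.map (act f)) = (expand k w).map (actL k f) := by
  induction w with
  | nil => rfl
  | cons x w ih =>
    simp only [expand, List.map_cons, List.flatMap_cons, List.map_append] at ih ⊢
    rw [ih, ex1_act]

theorem mem_ex1 {k : ℕ} {x : ℕ × Bool} {z : ℕ × ℕ} : z ∈ ex1 k x ↔ z.1 = x.1 ∧ z.2 < k := by
  obtain ⟨a, j⟩ := z
  unfold ex1
  simp only [List.mem_map, List.mem_range, Prod.mk.injEq]
  constructor
  · rintro ⟨i, hi, h, rfl⟩
    refine ⟨h.symm, ?_⟩
    split_ifs <;> omega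
  · rintro ⟨rfl, h⟩
    cases x.2
    · exact ⟨k - 1 - j, by omega, rfl, by simp; omega⟩
    · exact ⟨j, h, rfl, by simp⟩

theorem ex1_nodup (k : ℕ) (x : ℕ × Bool) : (ex1 k x).Nodup := by
  unfold ex1
  refine List.Nodup.map_on ?_ List.nodup_range
  intro i hi j hj h
  rw [List.mem_range] at hi hj
  simp only [Prod.mk.injEq, true_and] at h
  split_ifs at h <;> omega

theorem mem_expand_lt {k : ℕ} {w : List (ℕ × Bool)} {z : ℕ × ℕ} (h : z ∈ expand k w) :
    z.2 < k := by
  unfold expand at h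
  rw [List.mem_flatMap] at h
  obtain ⟨x, _, hx⟩ := h
  exact (mem_ex1.mp hx).2

theorem count_expand_le (k : ℕ) (w : List (ℕ × Bool)) (z : ℕ × ℕ) :
    (expand k w).count z ≤ (w.map Prod.fst).count z.1 := by
  induction w with
  | nil => simp [expand]
  | cons x w ih =>
    have e : expand k (x :: w) = ex1 k x ++ expand k w := by simp [expand]
    rw [e, List.count_append, List.map_cons, List.count_cons]
    by_cases h : x.1 = z.1
    · have := List.nodup_iff_count_le_one.mp (ex1_nodup k x) z
      simp only [h, beq_self_eq_true, if_true]
      omega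
    · have : z ∉ ex1 k x := fun hz => h (mem_ex1.mp hz).1.symm
      rw [List.count_eq_zero.mpr this]
      omega

theorem length_ex1 (k : ℕ) (x : ℕ × Bool) : (ex1 k x).length = k := by simp [ex1]

theorem expand_ne_nil {k : ℕ} (hk : 1 ≤ k) {w : List (ℕ × Bool)} (hw : w ≠ []) :
    expand k w ≠ [] := by
  cases w with
  | nil => exact absurd rfl hw
  | cons x w =>
    intro h
    have : ex1 k x = [] := by
      simp only [expand, List.flatMap_cons, List.append_eq_nil_iff] at h
      exact h.1
    have h2 := length_ex1 k x
    rw [this] at h2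
    simp at h2
    omega

/-- The relabelling that results from gluing the adjacent bundles `x` and `y`. -/
def glueMap (x y : ℕ × Bool) (z : ℕ) : ℕ × Bool :=
  if z = y.1 then (x.1, !(x.2 == y.2)) else (z, true)

theorem lg_bundleGlue {k : ℕ} (hk : 1 ≤ k) (m : ℕ) (A B : List (ℕ × Bool)) (x y : ℕ × Bool)
    (hA : A ≠ []) (hxy : x.1 ≠ y.1) (hc : ((A ++ B).map Prod.fst).count x.1 ≤ 1) :
    IsMinorOf (lg m (expand k ((A ++ B).map (act (glueMap x y)))))
      (lg (m + k) (expand k (A ++ x :: y :: B))) := by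
  have h := lg_glueMany (ex1 k y) m (ex1 k x) (expand k A) (expand k B)
    (fun z => if z.2 < k then actL k (glueMap x y) z else z) (expand_ne_nil hk hA)
    (by
      apply List.ext_getElem
      · simp [ex1]
      · intro i h1 h2
        have hi : i < k := by simpa [ex1] using h1
        simp only [ex1, List.getElem_map, List.getElem_range, List.getElem_reverse,
          List.length_map, List.length_range, actL, glueMap]
        rcases x with ⟨a, s⟩
        rcases y with ⟨b, t⟩
        have hlt : (if t = true then i else k - 1 - i) < k := by split_ifs <;> omega
        rw [if_pos hlt]
        cases s <;> cases t <;> simp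
        omega)
    (by
      intro z hz
      rw [mem_ex1] at hz
      by_cases hzk : z.2 < k
      · have : z.1 ≠ y.1 := fun h => hz ⟨h, hzk⟩
        simp [hzk, actL, glueMap, this]
      · simp [hzk])
    (ex1_nodup k y) (ex1_nodup k x)
    (by
      intro z hz hz'
      rw [mem_ex1] at hz hz'
      exact hxy (hz.1.symm.trans hz'.1))
    (by
      intro z hz
      rw [← expand_append]
      have hz1 := count_expand_le k (A ++ B) z
      rw [(mem_ex1.mp hz).1] at hz1
      convert Nat.le_trans hz1 hc)
  rw [length_ex1] at h
  have e1 : (expand k A ++ expand k B).map (fun z => if z.2 < k then actL k (glueMap x y) z else z)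
      = expand k ((A ++ B).map (act (glueMap x y))) := by
    rw [expand_act, expand_append]
    apply List.map_congr_left
    intro z hz
    rw [← expand_append] at hz
    rw [if_pos (mem_expand_lt hz)]
  have e2 : expand k A ++ ex1 k x ++ ex1 k y ++ expand k B = expand k (A ++ x :: y :: B) := by
    simp [expand]
  rw [e1, e2] at h
  exact h

/-- Glue the bundles at positions `p` and `p + 1` of a local word. -/
def stepW (p : ℕ) (w : List (ℕ × Bool)) : Option (List (ℕ × Bool)) :=
  match w.drop p with
  | x :: y :: v =>
    if x.1 ≠ y.1 ∧ ((w.take p ++ v).map Prod.fst).count x.1 ≤ 1 ∧ x.1 < 1000 ∧ y.1 < 1000 then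
      some ((w.take p ++ v).map (act (glueMap x y)))
    else none
  | _ => none

/-- Perform several gluings. -/
def runW : List ℕ → List (ℕ × Bool) → Option (List (ℕ × Bool))
  | [], w => some w
  | p :: ps, w => (stepW p w).bind (runW ps)

theorem map_act_context (f : ℕ → ℕ × Bool) (A : List (ℕ × Bool))
    (h : ∀ z ∈ A, f z.1 = (z.1, true)) : A.map (act f) = A := by
  rw [List.map_congr_left (g := id)]
  · simp
  · intro z hz
    rw [act, h z hz]
    rcases z with ⟨a, s⟩
    cases s <;> rfl

theorem lg_stepW {k : ℕ} (hk : 1 ≤ k) (m p : ℕ) (A B w w' : List (ℕ × Bool)) (hA : A ≠ [])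
    (hAc : ∀ z ∈ A, 1000 ≤ z.1) (hBc : ∀ z ∈ B, 1000 ≤ z.1) (h : stepW p w = some w') :
    IsMinorOf (lg m (expand k (A ++ w' ++ B))) (lg (m + k) (expand k (A ++ w ++ B))) := by
  unfold stepW at h
  split at h
  · rename_i x y v hv
    split_ifs at h with hcond
    · obtain ⟨h1, h2, h3, h4⟩ := hcond
      simp only [Option.some.injEq] at h
      set u := w.take p with hu
      have hw : w = u ++ x :: y :: v := by
        rw [← hv, hu, List.take_append_drop]
      have hA0 : (A.map Prod.fst).count x.1 = 0 := by
        rw [List.count_eq_zero]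
        intro hm
        rw [List.mem_map] at hm
        obtain ⟨z, hz, e⟩ := hm
        have := hAc z hz
        omega
      have hB0 : (B.map Prod.fst).count x.1 = 0 := by
        rw [List.count_eq_zero]
        intro hm
        rw [List.mem_map] at hm
        obtain ⟨z, hz, e⟩ := hm
        have := hBc z hz
        omega
      have hid : ∀ z : ℕ, 1000 ≤ z → glueMap x y z = (z, true) := by
        intro z hz
        have : z ≠ y.1 := by omega
        simp [glueMap, this]
      have g := lg_bundleGlue hk m (A ++ u) (v ++ B) x y (by simp [hA]) h1 (by
        simp only [List.map_append, List.count_append] at h2 ⊢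
        omega)
      have e1 : ((A ++ u) ++ (v ++ B)).map (act (glueMap x y)) = A ++ w' ++ B := by
        rw [← h]
        simp only [List.map_append, map_act_context _ A (fun z hz => hid _ (hAc z hz)),
          map_act_context _ B (fun z hz => hid _ (hBc z hz)), List.append_assoc]
      have e2 : (A ++ u) ++ x :: y :: (v ++ B) = A ++ w ++ B := by rw [hw]; simp
      rw [e1, e2] at g
      exact g
  · simp at h

theorem lg_runW {k : ℕ} (hk : 1 ≤ k) (A B : List (ℕ × Bool)) (hA : A ≠ [])
    (hAc : ∀ z ∈ A, 1000 ≤ z.1) (hBc : ∀ z ∈ B, 1000 ≤ z.1) (ps : List ℕ) :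
    ∀ (m : ℕ) (w w' : List (ℕ × Bool)), runW ps w = some w' →
    IsMinorOf (lg m (expand k (A ++ w' ++ B)))
      (lg (m + k * ps.length) (expand k (A ++ w ++ B))) := by
  induction ps with
  | nil =>
    intro m w w' h
    simp only [runW, Option.some.injEq] at h
    subst h
    exact lg_rows (by simp) _
  | cons p ps ih =>
    intro m w w' h
    simp only [runW, Option.bind_eq_some_iff] at h
    obtain ⟨w1, h1, h2⟩ := h
    refine (ih m w1 w' h2).trans ?_
    refine (lg_stepW hk _ p A B w w1 hA hAc hBc h1).trans ?_
    exact lg_rows (by simp [mul_add, add_assoc]) _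

end Bundles

section Blocks

/-- The signed word of a block with tag `t`: `none` is an empty block, `some true` a handle and
`some false` a crosscap. -/
def blkW (t : ℕ) : Option Bool → List (ℕ × Bool)
  | none => [(4 * t, true), (4 * t + 1, true), (4 * t + 2, true), (4 * t + 3, true)]
  | some true => [(4 * t, true), (4 * t + 1, true), (4 * t, false), (4 * t + 1, false)]
  | some false => [(4 * t, true), (4 * t + 1, true), (4 * t, true), (4 * t + 1, true)]

/-- The signed word of a list of blocks, with tags starting from `t`. -/
def wordOf : ℕ → List (Option Bool) → List (ℕ × Bool)
  | _, [] => []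
  | t, b :: l => blkW t b ++ wordOf (t + 1) l

/-- The word graph of order `k` for a list of blocks. -/
def mg (k : ℕ) (l : List (Option Bool)) :
    SimpleGraph (Fin k × Fin (expand k (wordOf 0 l)).length) :=
  lg k (expand k (wordOf 0 l))

theorem wordOf_append (A B : List (Option Bool)) : ∀ t : ℕ,
    wordOf t (A ++ B) = wordOf t A ++ wordOf (t + A.length) B := by
  induction A with
  | nil => intro t; simp [wordOf]
  | cons b A ih =>
    intro t
    simp only [List.cons_append, wordOf, ih, List.append_assoc, List.length_cons]
    rw [show t + 1 + A.length = t + (A.length + 1) by omega]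

theorem wordOf_shift (l : List (Option Bool)) : ∀ s t : ℕ,
    wordOf (s + t) l = (wordOf s l).map (fun x => (x.1 + 4 * t, x.2)) := by
  induction l with
  | nil => intro s t; rfl
  | cons b l ih =>
    intro s t
    simp only [wordOf, List.map_append]
    rw [show s + t + 1 = (s + 1) + t by omega, ih]
    congr 1
    rcases b with _ | _ | _ <;> simp [blkW] <;> omega

theorem wordOf_bounds (l : List (Option Bool)) : ∀ t : ℕ, ∀ x ∈ wordOf t l,
    4 * t ≤ x.1 ∧ x.1 < 4 * t + 4 * l.length := by
  induction l with
  | nil => intro t x hx; simp [wordOf] at hx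
  | cons b l ih =>
    intro t x hx
    simp only [wordOf, List.mem_append] at hx
    rw [List.length_cons]
    rcases hx with hx | hx
    · rcases b with _ | _ | _ <;> simp [blkW] at hx <;>
        rcases hx with rfl | rfl | rfl | rfl <;> simp only <;> omega
    · have := ih _ x hx
      omega

theorem expand_wordOf_head {k : ℕ} (hk : 1 ≤ k) {l : List (Option Bool)} (hl : l ≠ [])
    (M : List (ℕ × ℕ)) : (expand k (wordOf 0 l) ++ M).head? = some (0, 0) := by
  obtain ⟨k, rfl⟩ : ∃ k', k = k' + 1 := ⟨k - 1, by omega⟩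
  cases l with
  | nil => exact absurd rfl hl
  | cons b l =>
    rcases b with _ | _ | _ <;>
      simp [wordOf, blkW, expand, ex1, List.range_succ_eq_map]

theorem ex1_sublist {k K : ℕ} (h : k ≤ K) (x : ℕ × Bool) : (ex1 k x).Sublist (ex1 K x) := by
  obtain ⟨d, rfl⟩ := Nat.exists_eq_add_of_le h
  rcases x with ⟨a, s⟩
  cases s
  · have : ex1 (k + d) (a, false) =
        (List.range d).map (fun j => (a, k + d - 1 - j)) ++ ex1 k (a, false) := by
      unfold ex1
      rw [Nat.add_comm k d, List.range_add, List.map_append, List.map_map]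
      congr 1
      apply List.map_congr_left
      intro j _
      simp only [Function.comp, Prod.mk.injEq, true_and, Bool.false_eq_true, if_false]
      omega
    rw [this]
    exact List.sublist_append_right _ _
  · unfold ex1
    rw [List.range_add, List.map_append]
    exact List.sublist_append_left _ _

theorem expand_sublist {k K : ℕ} (h : k ≤ K) (w : List (ℕ × Bool)) :
    (expand k w).Sublist (expand K w) := by
  induction w with
  | nil => simp [expand]
  | cons x w ih =>
    simp only [expand, List.flatMap_cons] at ih ⊢
    exact (ex1_sublist h x).append ih

theorem expand_sublist_of_sublist (k : ℕ) {w w' : List (ℕ × Bool)} (h : w'.Sublist w) :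
    (expand k w').Sublist (expand k w) := by
  induction h with
  | slnil => exact List.Sublist.refl _
  | @cons l1 l2 a h ih =>
    simp only [expand, List.flatMap_cons] at ih ⊢
    exact ih.trans (List.sublist_append_right _ _)
  | @cons_cons l1 l2 a h ih =>
    simp only [expand, List.flatMap_cons] at ih ⊢
    exact (List.Sublist.refl _).append ih

theorem mg_mono {k K : ℕ} (hk : 1 ≤ k) (h : k ≤ K) {l : List (Option Bool)} (hl : l ≠ []) :
    IsMinorOf (mg k l) (mg K l) := by
  have e1 := expand_wordOf_head hk hl []
  have e2 := expand_wordOf_head (hk.trans h) hl []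
  rw [List.append_nil] at e1 e2
  refine (lg_rows h _).trans (lg_sublist K (expand_sublist h _) ?_ (e1.trans e2.symm))
  intro h0
  rw [h0] at e1
  simp at e1

/-- Cut every bundle into `q` bundles. -/
def refW (q : ℕ) (w : List (ℕ × Bool)) : List (ℕ × Bool) :=
  w.flatMap (fun x => (List.range q).map (fun r => (x.1 * q + (if x.2 then r else q - 1 - r), x.2)))

theorem map_range_mul {β : Type*} (q k : ℕ) (F : ℕ → β) :
    (List.range (q * k)).map F =
      (List.range q).flatMap (fun r => (List.range k).map (fun j => F (r * k + j))) := by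
  induction q with
  | zero => simp
  | succ q ih =>
    rw [Nat.succ_mul, List.range_add, List.map_append, ih, List.range_succ, List.flatMap_append]
    simp [Function.comp_def]

/-- The letter map undoing shift and refinement. -/
def unref (t k : ℕ) (y : ℕ × ℕ) : ℕ × ℕ :=
  if 1000 ≤ y.1 then (y.1 - 1000, y.2) else (y.1 / 32 + 4 * t, y.1 % 32 * k + y.2)

/-- Shift the letters of the context. -/
def sh (w : List (ℕ × Bool)) : List (ℕ × Bool) := w.map (fun x => (x.1 + 1000, x.2))

theorem unref_sh (t k : ℕ) (w : List (ℕ × Bool)) :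
    (expand k (sh w)).map (unref t k) = expand k w := by
  induction w with
  | nil => rfl
  | cons x w ih =>
    simp only [expand, sh, List.map_cons, List.flatMap_cons, List.map_append] at ih ⊢
    rw [ih]
    congr 1
    simp [ex1, unref]

theorem unref_refW (t k : ℕ) (w : List (ℕ × Bool)) (hw : ∀ x ∈ w, x.1 < 31) :
    (expand k (refW 32 w)).map (unref t k) =
      expand (32 * k) (w.map (fun x => (x.1 + 4 * t, x.2))) := by
  induction w with
  | nil => rfl
  | cons x w ih =>
    have hx := hw x (by simp)
    have ih := ih (fun z hz => hw z (by simp [hz]))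
    simp only [expand, refW, List.map_cons, List.flatMap_cons, List.map_append,
      List.flatMap_append] at ih ⊢
    rw [ih]
    congr 1
    unfold ex1
    rw [map_range_mul, List.flatMap_map, List.map_flatMap]
    apply List.flatMap_congr
    intro r hr
    rw [List.mem_range] at hr
    rw [List.map_map]
    apply List.map_congr_left
    intro j hj
    rw [List.mem_range] at hj
    rcases x with ⟨a, s⟩
    simp only at hx
    simp only [Function.comp, unref]
    cases s
    · simp only [Bool.false_eq_true, if_false, Nat.reduceSub]
      obtain ⟨c, hc⟩ : ∃ c, c = 31 - r := ⟨_, rfl⟩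
      rw [← hc, if_neg (by omega), show (a * 32 + c) / 32 = a by omega,
        show (a * 32 + c) % 32 = c by omega]
      simp only [Prod.mk.injEq, true_and]
      have hr' : r = 31 - c := by omega
      have hc' : c ≤ 31 := by omega
      have h1 : c * k + r * k = 31 * k := by
        rw [← Nat.add_mul, hr', Nat.add_sub_cancel' hc']
      omega
    · simp only [if_true]
      rw [if_neg (by omega), show (a * 32 + r) / 32 = a by omega,
        show (a * 32 + r) % 32 = r by omega]

theorem sh_ge (w : List (ℕ × Bool)) : ∀ z ∈ sh w, 1000 ≤ z.1 := by
  intro z hz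
  unfold sh at hz
  rw [List.mem_map] at hz
  obtain ⟨x, _, rfl⟩ := hz
  simp

theorem mg_step (P P' : List (Option Bool)) (w0 wf : List (ℕ × Bool)) (ps : List ℕ)
    (tab : ℕ → ℕ × Bool) (hP : ∀ x ∈ wordOf 0 P, x.1 < 31)
    (h0 : w0.Sublist (refW 32 (wordOf 0 P)))
    (hrun : runW ps w0 = some wf) (htab : (wordOf 0 P').map (act tab) = wf)
    (hps : ps.length ≤ 31) (A B : List (Option Bool)) (hA : A ≠ []) (k : ℕ) (hk : 1 ≤ k) :
    IsMinorOf (mg k (A ++ P' ++ B)) (mg (32 * k) (A ++ P ++ B)) := by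
  set t := A.length with ht
  have hkK : k ≤ 32 * k := by omega
  -- the two words
  have es : wordOf 0 (A ++ P ++ B) = wordOf 0 A ++ wordOf t P ++ wordOf (t + P.length) B := by
    rw [wordOf_append, wordOf_append, List.length_append]
    simp [ht]
  have et : wordOf 0 (A ++ P' ++ B) = wordOf 0 A ++ wordOf t P' ++ wordOf (t + P'.length) B := by
    rw [wordOf_append, wordOf_append, List.length_append]
    simp [ht]
  set wA := wordOf 0 A with hwA
  set wB := wordOf (t + P.length) B with hwB
  have hwA0 : wA ≠ [] := by
    cases A with
    | nil => exact absurd rfl hA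
    | cons b A => rcases b with _ | _ | _ <;> simp [hwA, wordOf, blkW]
  have hsA0 : sh wA ≠ [] := by simpa [sh] using hwA0
  -- first step
  have s1 : IsMinorOf (lg (32 * k) (expand k wA ++ expand (32 * k) (wordOf t P) ++ expand k wB))
      (mg (32 * k) (A ++ P ++ B)) := by
    unfold mg
    rw [es, expand_append, expand_append]
    refine lg_sublist _ (((expand_sublist hkK _).append (List.Sublist.refl _)).append
      (expand_sublist hkK _)) ?_ ?_
    · have := expand_ne_nil hk hwA0
      simp [this]
    · rw [List.append_assoc, List.append_assoc, expand_wordOf_head hk hA,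
        expand_wordOf_head (hk.trans hkK) hA]
  -- refinement
  have s2 : IsMinorOf (lg (32 * k) (expand k (sh wA ++ refW 32 (wordOf 0 P) ++ sh wB)))
      (lg (32 * k) (expand k wA ++ expand (32 * k) (wordOf t P) ++ expand k wB)) := by
    have := lg_unmap (32 * k) (expand k (sh wA ++ refW 32 (wordOf 0 P) ++ sh wB)) (unref t k)
    have e : (expand k (sh wA ++ refW 32 (wordOf 0 P) ++ sh wB)).map (unref t k) =
        expand k wA ++ expand (32 * k) (wordOf t P) ++ expand k wB := by
      have h1 := wordOf_shift P 0 t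
      rw [Nat.zero_add] at h1
      rw [expand_append, expand_append, List.map_append, List.map_append, unref_sh, unref_sh,
        unref_refW t k _ hP, h1]
    rw [e] at this
    exact this
  -- sublist
  have s3 : IsMinorOf (lg (32 * k) (expand k (sh wA ++ w0 ++ sh wB)))
      (lg (32 * k) (expand k (sh wA ++ refW 32 (wordOf 0 P) ++ sh wB))) := by
    rw [expand_append, expand_append, expand_append, expand_append, List.append_assoc,
      List.append_assoc]
    exact lg_sublist_aux _ ((expand_sublist_of_sublist k h0).append (List.Sublist.refl _)) _
      (expand_ne_nil hk hsA0)
  -- gluing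
  have s4 : IsMinorOf (lg k (expand k (sh wA ++ wf ++ sh wB)))
      (lg (32 * k) (expand k (sh wA ++ w0 ++ sh wB))) := by
    refine (lg_runW hk (sh wA) (sh wB) hsA0 (sh_ge _) (sh_ge _) ps k w0 wf hrun).trans ?_
    refine lg_rows ?_ _
    have := Nat.mul_le_mul_left k hps
    omega
  -- relabelling
  set f : ℕ → ℕ × Bool := fun z => if z < 4 * t then (z + 1000, true) else
    if z < 4 * t + 4 * P'.length then tab (z - 4 * t) else
      (z - 4 * P'.length + 4 * P.length + 1000, true) with hf
  have s5 : IsMinorOf (mg k (A ++ P' ++ B)) (lg k (expand k (sh wA ++ wf ++ sh wB))) := by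
    have := lg_unmap k (expand k (wordOf 0 (A ++ P' ++ B))) (actL k f)
    have e : (expand k (wordOf 0 (A ++ P' ++ B))).map (actL k f) =
        expand k (sh wA ++ wf ++ sh wB) := by
      rw [← expand_act]
      congr 1
      rw [et, List.map_append, List.map_append]
      congr 1
      · congr 1
        · unfold sh
          apply List.map_congr_left
          intro x hx
          have := wordOf_bounds A 0 x hx
          have hlt : x.1 < 4 * t := by omega
          simp [act, hf, hlt]
        · have h1 := wordOf_shift P' 0 t
          rw [Nat.zero_add] at h1
          rw [h1, List.map_map, ← htab]
          apply List.map_congr_left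
          intro x hx
          have := wordOf_bounds P' 0 x hx
          have h2 : ¬ (x.1 + 4 * t < 4 * t) := by omega
          have h3 : x.1 + 4 * t < 4 * t + 4 * P'.length := by omega
          simp only [Function.comp, act, hf, h2, h3, if_false, if_true, Nat.add_sub_cancel]
      · have h1 := wordOf_shift B 0 (t + P'.length)
        have h2 := wordOf_shift B 0 (t + P.length)
        rw [Nat.zero_add] at h1 h2
        rw [hwB, h1, h2, sh, List.map_map, List.map_map]
        apply List.map_congr_left
        intro x hx
        have h3 : ¬ (x.1 + 4 * (t + P'.length) < 4 * t) := by omega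
        have h4 : ¬ (x.1 + 4 * (t + P'.length) < 4 * t + 4 * P'.length) := by omega
        simp only [Function.comp, act, hf, h3, h4, if_false, Prod.mk.injEq]
        constructor
        · omega
        · cases x.2 <;> rfl
    rw [e] at this
    exact this
  exact s5.trans (s4.trans (s3.trans (s2.trans s1)))

/-- An increasing run of `n` positive letters from `a`. -/
def upB (a n : ℕ) : List (ℕ × Bool) := (List.range n).map (fun r => (a + r, true))

/-- A decreasing run of `n` negative letters down to `a`. -/
def downB (a n : ℕ) : List (ℕ × Bool) := (List.range n).map (fun r => (a + (n - 1 - r), false))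

theorem mg_step_HC_CCC (A B : List (Option Bool)) (hA : A ≠ []) (k : ℕ) (hk : 1 ≤ k) :
    IsMinorOf (mg k (A ++ [some false, some false, some false] ++ B)) (mg (32 * k) (A ++ [some true, some false] ++ B)) :=
  mg_step [some true, some false] [some false, some false, some false]
    (upB 0 8 ++ upB 32 12 ++ downB 0 8 ++ downB 32 12 ++ upB 128 14 ++ upB 128 14)
    [(3, false), (2, false), (3, false), (2, false), (1, false), (0, false), (1, false), (0,
    false), (140, true), (141, true), (140, true), (141, true)]
    [39, 38, 37, 36, 35, 34, 33, 32, 31, 30, 29, 28, 7, 6, 5, 4, 3, 2, 1, 0, 3, 2, 1, 0, 5, 4, 3,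
    2]
    (fun z => [(3, false), (2, false), (0, true), (0, true), (1, false), (0, false), (0, true), (0, true), (140, true), (141, true)].getD z (0, true))
    (by decide) (by decide +kernel) (by decide +kernel) (by decide +kernel) (by decide) A B hA k hk

theorem mg_step_CCC_HC (A B : List (Option Bool)) (hA : A ≠ []) (k : ℕ) (hk : 1 ≤ k) :
    IsMinorOf (mg k (A ++ [some true, some false] ++ B)) (mg (32 * k) (A ++ [some false, some false, some false] ++ B)) :=
  mg_step [some false, some false, some false] [some true, some false]
    (upB 0 4 ++ upB 0 4 ++ upB 128 11 ++ upB 128 11 ++ upB 256 9 ++ upB 256 9)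
    [(0, false), (136, false), (0, true), (136, true), (263, true), (264, true), (263, true),
    (264, true)]
    [7, 6, 5, 4, 21, 20, 19, 18, 17, 16, 15, 3, 2, 1, 0, 2, 1, 0, 2, 1]
    (fun z => [(0, false), (136, false), (0, true), (0, true), (263, true), (264, true)].getD z (0, true))
    (by decide) (by decide +kernel) (by decide +kernel) (by decide +kernel) (by decide) A B hA k hk

theorem mg_step_CH_CCC (A B : List (Option Bool)) (hA : A ≠ []) (k : ℕ) (hk : 1 ≤ k) :
    IsMinorOf (mg k (A ++ [some false, some false, some false] ++ B)) (mg (32 * k) (A ++ [some false, some true] ++ B)) :=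
  mg_step [some false, some true] [some false, some false, some false]
    (upB 0 6 ++ upB 0 6 ++ upB 128 12 ++ upB 160 8 ++ downB 128 12 ++ downB 160 8)
    [(0, true), (1, true), (0, true), (1, true), (2, true), (3, true), (2, true), (3, true), (4,
    true), (5, true), (4, true), (5, true)]
    [11, 10, 9, 8, 7, 6, 11, 10, 9, 8, 7, 6, 7, 6, 5, 4, 3, 2, 7, 6]
    (fun z => [(0, true), (1, true), (0, true), (0, true), (2, true), (3, true), (0, true), (0, true), (4, true), (5, true)].getD z (0, true))
    (by decide) (by decide +kernel) (by decide +kernel) (by decide +kernel) (by decide) A B hA k hk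

theorem mg_step_CCC_CH (A B : List (Option Bool)) (hA : A ≠ []) (k : ℕ) (hk : 1 ≤ k) :
    IsMinorOf (mg k (A ++ [some false, some true] ++ B)) (mg (32 * k) (A ++ [some false, some false, some false] ++ B)) :=
  mg_step [some false, some false, some false] [some false, some true]
    (upB 0 3 ++ upB 0 3 ++ upB 128 11 ++ upB 128 11 ++ upB 256 4 ++ upB 256 4)
    [(132, true), (133, true), (132, true), (133, true), (134, true), (135, true), (134, false),
    (135, false)]
    [5, 4, 3, 21, 20, 19, 18, 10, 9, 8, 11, 10, 9, 2]
    (fun z => [(132, true), (133, true), (0, true), (0, true), (134, true), (135, true)].getD z (0, true))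
    (by decide) (by decide +kernel) (by decide +kernel) (by decide +kernel) (by decide) A B hA k hk

end Blocks

section Normalize

theorem exists_adjacent (l : List Bool) (h1 : true ∈ l) (h2 : false ∈ l) :
    ∃ A B, l = A ++ [true, false] ++ B ∨ l = A ++ [false, true] ++ B := by
  induction l with
  | nil => simp at h1
  | cons a l ih =>
    by_cases hb : true ∈ l ∧ false ∈ l
    · obtain ⟨A, B, h | h⟩ := ih hb.1 hb.2
      · exact ⟨a :: A, B, Or.inl (by rw [h]; simp)⟩
      · exact ⟨a :: A, B, Or.inr (by rw [h]; simp)⟩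
    · cases l with
      | nil => cases a <;> simp at h1 h2
      | cons b l =>
        cases a <;> cases b <;> simp_all
        · exact ⟨[], l, Or.inr rfl⟩
        · exact ⟨[], l, Or.inl rfl⟩

theorem mg_norm (h : ℕ) : ∀ (l : List Bool), l.count true = h → false ∈ l → ∀ k : ℕ, 1 ≤ k →
    IsMinorOf (mg k (none :: List.replicate (2 * h + l.count false) (some false)))
      (mg (32 ^ h * k) (none :: l.map some)) ∧
    IsMinorOf (mg k (none :: l.map some))
      (mg (32 ^ h * k) (none :: List.replicate (2 * h + l.count false) (some false))) := by
  induction h with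
  | zero =>
    intro l hl _ k hk
    have e : l = List.replicate (l.count false) false := by
      rw [List.eq_replicate_iff]
      have ht : true ∉ l := List.count_eq_zero.mp hl
      have hall : ∀ b ∈ l, b = false := by
        intro b hb
        cases b
        · rfl
        · exact absurd hb ht
      exact ⟨(List.count_eq_length.mpr (fun b hb => (hall b hb).symm)).symm, hall⟩
    have e2 : l.map some = List.replicate (2 * 0 + l.count false) (some false) := by
      conv_lhs => rw [e]
      rw [List.map_replicate, Nat.mul_zero, Nat.zero_add]
    rw [e2]
    have hle : k ≤ 32 ^ 0 * k := by simp
    exact ⟨mg_mono hk hle (by simp), mg_mono hk hle (by simp)⟩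
  | succ h ih =>
    intro l hl hf k hk
    have ht : true ∈ l := List.count_pos_iff.mp (by omega)
    obtain ⟨A, B, e⟩ := exists_adjacent l ht hf
    set l' := A ++ [false, false, false] ++ B with hl'
    have c1 : l'.count true = h := by
      rcases e with e | e <;> rw [e] at hl <;>
        simp [hl', List.count_append] at hl ⊢ <;> omega
    have c2 : 2 * h + l'.count false = 2 * (h + 1) + l.count false := by
      rcases e with e | e <;> rw [e] <;>
        simp [hl', List.count_append] <;> omega
    have hpow : 1 ≤ 32 ^ h := Nat.one_le_pow _ _ (by norm_num)
    have hk2 : 1 ≤ 32 ^ h * k := Nat.mul_pos hpow hk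
    have hk3 : 1 ≤ 32 * k := by omega
    have p1 : 32 ^ (h + 1) * k = 32 * (32 ^ h * k) := by ring
    have p2 : 32 ^ (h + 1) * k = 32 ^ h * (32 * k) := by ring
    have i1 := (ih l' c1 (by simp [hl']) k hk).1
    have i2 := (ih l' c1 (by simp [hl']) (32 * k) hk3).2
    rw [c2] at i1 i2
    have em : none :: l'.map some =
        (none :: A.map some) ++ [some false, some false, some false] ++ B.map some := by
      simp [hl']
    rw [em] at i1 i2
    rcases e with e | e
    · have em2 : none :: l.map some =
          (none :: A.map some) ++ [some true, some false] ++ B.map some := by simp [e]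
      rw [em2]
      constructor
      · rw [p1]
        exact i1.trans (mg_step_HC_CCC _ _ (by simp) _ hk2)
      · rw [p2]
        exact (mg_step_CCC_HC _ _ (by simp) _ hk).trans i2
    · have em2 : none :: l.map some =
          (none :: A.map some) ++ [some false, some true] ++ B.map some := by simp [e]
      rw [em2]
      constructor
      · rw [p1]
        exact i1.trans (mg_step_CH_CCC _ _ (by simp) _ hk2)
      · rw [p2]
        exact (mg_step_CCC_CH _ _ (by simp) _ hk).trans i2

end Normalize

section Endpoints

theorem expand_getElem? (k : ℕ) (r : ℕ) (hr : r < k) (w : List (ℕ × Bool)) : ∀ u : ℕ,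
    (expand k w)[u * k + r]? = (w[u]?).map (fun x => (x.1, if x.2 then r else k - 1 - r)) := by
  induction w with
  | nil => intro u; simp [expand]
  | cons x w ih =>
    intro u
    have e : expand k (x :: w) = ex1 k x ++ expand k w := by simp [expand]
    rw [e]
    cases u with
    | zero =>
      rw [List.getElem?_append_left (by rw [length_ex1]; omega)]
      simp [ex1, hr]
    | succ u =>
      rw [List.getElem?_append_right (by rw [length_ex1, Nat.succ_mul]; omega), length_ex1,
        show (u + 1) * k + r - k = u * k + r by rw [Nat.succ_mul]; omega, ih u]
      simp

theorem length_blkW (t : ℕ) (b : Option Bool) : (blkW t b).length = 4 := by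
  rcases b with _ | _ | _ <;> rfl

theorem wordOf_getElem? (s : ℕ) (hs : s < 4) (b : Option Bool) (l : List (Option Bool)) :
    ∀ t i : ℕ, l[i]? = some b → (wordOf t l)[4 * i + s]? = (blkW (t + i) b)[s]? := by
  induction l with
  | nil => intro t i h; simp at h
  | cons c l ih =>
    intro t i h
    rw [wordOf]
    cases i with
    | zero =>
      simp only [List.getElem?_cons_zero, Option.some.injEq] at h
      subst h
      rw [List.getElem?_append_left (by rw [length_blkW]; omega)]
      simp
    | succ i =>
      rw [List.getElem?_cons_succ] at h
      rw [List.getElem?_append_right (by rw [length_blkW]; omega), length_blkW,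
        show 4 * (i + 1) + s - 4 = 4 * i + s by omega, ih (t + 1) i h,
        show t + 1 + i = t + (i + 1) by omega]

theorem word_getElem? {K t s r : ℕ} {b : Option Bool} {l : List (Option Bool)} (hs : s < 4)
    (hr : r < K) (hb : l[t]? = some b) : (expand K (wordOf 0 l))[4 * K * t + s * K + r]? =
      ((blkW t b)[s]?).map (fun x => (x.1, if x.2 then r else K - 1 - r)) := by
  have h := expand_getElem? K r hr (wordOf 0 l) (4 * t + s)
  rw [wordOf_getElem? s hs b l 0 t hb, Nat.zero_add] at h
  rw [← h]
  congr 1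
  ring

theorem length_wordOf (l : List (Option Bool)) : ∀ t, (wordOf t l).length = 4 * l.length := by
  induction l with
  | nil => intro t; rfl
  | cons b l ih =>
    intro t
    rw [wordOf, List.length_append, ih, length_blkW, List.length_cons]
    ring

theorem length_expand (k : ℕ) (w : List (ℕ × Bool)) : (expand k w).length = w.length * k := by
  induction w with
  | nil => simp [expand]
  | cons x w ih =>
    have e : expand k (x :: w) = ex1 k x ++ expand k w := by simp [expand]
    rw [e, List.length_append, ih, length_ex1, List.length_cons]
    ring

theorem length_word (K : ℕ) (l : List (Option Bool)) :
    (expand K (wordOf 0 l)).length = 4 * l.length * K := by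
  rw [length_expand, length_wordOf]

theorem decomp {n K i : ℕ} (hi : i < 4 * n * K) :
    ∃ t s r, t < n ∧ s < 4 ∧ r < K ∧ i = 4 * K * t + s * K + r := by
  have hK : 0 < K := by
    rcases Nat.eq_zero_or_pos K with h | h
    · subst h; simp at hi
    · exact h
  have h1 : i / K < 4 * n := Nat.div_lt_of_lt_mul (by rw [Nat.mul_comm]; exact hi)
  refine ⟨i / K / 4, i / K % 4, i % K, by omega, by omega, Nat.mod_lt _ hK, ?_⟩
  have h2 := Nat.div_add_mod i K
  have h3 := Nat.div_add_mod (i / K) 4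
  conv_lhs => rw [← h2, ← h3]
  ring

/-- The chords of the word of a list of blocks. -/
theorem word_chords {n K : ℕ} {l : List (Option Bool)} (hl : l.length = n) {i j : ℕ}
    (hi : i < 4 * n * K) (hj : j < 4 * n * K) (hij : i ≠ j)
    (h : (expand K (wordOf 0 l))[i]? = (expand K (wordOf 0 l))[j]?) :
    ∃ t, t < n ∧
      ((l[t]? = some (some true) ∧ ∃ r, r < K ∧
        ((i = 4 * K * t + r ∧ j + r + 1 = 4 * K * t + 3 * K) ∨
         (i = 4 * K * t + K + r ∧ j + r + 1 = 4 * K * t + 4 * K) ∨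
         (j = 4 * K * t + r ∧ i + r + 1 = 4 * K * t + 3 * K) ∨
         (j = 4 * K * t + K + r ∧ i + r + 1 = 4 * K * t + 4 * K))) ∨
       (l[t]? = some (some false) ∧ ∃ r, r < 2 * K ∧
        ((i = 4 * K * t + r ∧ j = 4 * K * t + 2 * K + r) ∨
         (j = 4 * K * t + r ∧ i = 4 * K * t + 2 * K + r)))) := by
  obtain ⟨t, s, r, ht, hs, hr, rfl⟩ := decomp hi
  obtain ⟨t', s', r', ht', hs', hr', rfl⟩ := decomp hj
  obtain ⟨b, hb⟩ : ∃ b, l[t]? = some b := ⟨l[t], List.getElem?_eq_getElem (by omega)⟩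
  obtain ⟨b', hb'⟩ : ∃ b, l[t']? = some b := ⟨l[t'], List.getElem?_eq_getElem (by omega)⟩
  rw [word_getElem? hs hr hb, word_getElem? hs' hr' hb'] at h
  have hx : ∀ (t s : ℕ) (b : Option Bool), s < 4 → ∃ x, (blkW t b)[s]? = some x ∧ 4 * t ≤ x.1 ∧
      x.1 < 4 * t + 4 := by
    intro t s b hs
    interval_cases s <;> rcases b with _ | _ | _ <;> simp [blkW]
  have htt : t = t' := by
    obtain ⟨x, e, h1, h2⟩ := hx t s b hs
    obtain ⟨x', e', h1', h2'⟩ := hx t' s' b' hs'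
    rw [e, e'] at h
    simp only [Option.map_some, Option.some.injEq, Prod.mk.injEq] at h
    omega
  subst htt
  have hbb : b = b' := by
    rw [hb] at hb'
    exact Option.some.inj hb'
  subst hbb
  refine ⟨t, ht, ?_⟩
  rw [hb]
  generalize 4 * K * t = T at *
  rcases b with _ | _ | _
  · exfalso
    interval_cases s <;> interval_cases s' <;> simp [blkW] at h <;> omega
  · right
    refine ⟨rfl, ?_⟩
    interval_cases s <;> interval_cases s' <;> simp [blkW] at h <;>
      first
      | (exfalso; omega)
      | exact ⟨r, by omega, Or.inl ⟨by omega, by omega⟩⟩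
      | exact ⟨r + K, by omega, Or.inl ⟨by omega, by omega⟩⟩
      | exact ⟨r, by omega, Or.inr ⟨by omega, by omega⟩⟩
      | exact ⟨r + K, by omega, Or.inr ⟨by omega, by omega⟩⟩
  · left
    refine ⟨rfl, ?_⟩
    interval_cases s <;> interval_cases s' <;> simp [blkW] at h <;>
      first
      | (exfalso; omega)
      | exact ⟨r, by omega, Or.inl ⟨by omega, by omega⟩⟩
      | exact ⟨r, by omega, Or.inr (Or.inl ⟨by omega, by omega⟩)⟩
      | exact ⟨r', by omega, Or.inr (Or.inr (Or.inl ⟨by omega, by omega⟩))⟩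
      | exact ⟨r', by omega, Or.inr (Or.inr (Or.inr ⟨by omega, by omega⟩))⟩

theorem word_handle_one {K t r : ℕ} {l : List (Option Bool)} (hb : l[t]? = some (some true))
    (hr : r < K) : (expand K (wordOf 0 l))[4 * K * t + r]? =
      (expand K (wordOf 0 l))[4 * K * t + 3 * K - r - 1]? := by
  have h1 := word_getElem? (K := K) (s := 0) (by omega) hr hb
  have h2 := word_getElem? (K := K) (s := 2) (r := K - 1 - r) (by omega) (by omega) hb
  rw [show 4 * K * t + 0 * K + r = 4 * K * t + r by omega] at h1
  rw [show 4 * K * t + 2 * K + (K - 1 - r) = 4 * K * t + 3 * K - r - 1 by omega] at h2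
  rw [h1, h2]
  simp [blkW]
  omega

theorem word_handle_two {K t r : ℕ} {l : List (Option Bool)} (hb : l[t]? = some (some true))
    (hr : r < K) : (expand K (wordOf 0 l))[4 * K * t + K + r]? =
      (expand K (wordOf 0 l))[4 * K * t + 4 * K - r - 1]? := by
  have h1 := word_getElem? (K := K) (s := 1) (by omega) hr hb
  have h2 := word_getElem? (K := K) (s := 3) (r := K - 1 - r) (by omega) (by omega) hb
  rw [show 4 * K * t + 1 * K + r = 4 * K * t + K + r by omega] at h1
  rw [show 4 * K * t + 3 * K + (K - 1 - r) = 4 * K * t + 4 * K - r - 1 by omega] at h2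
  rw [h1, h2]
  simp [blkW]
  omega

theorem word_crosscap {K t r : ℕ} {l : List (Option Bool)} (hb : l[t]? = some (some false))
    (hr : r < 2 * K) : (expand K (wordOf 0 l))[4 * K * t + r]? =
      (expand K (wordOf 0 l))[4 * K * t + 2 * K + r]? := by
  by_cases hrK : r < K
  · have h1 := word_getElem? (K := K) (s := 0) (by omega) hrK hb
    have h2 := word_getElem? (K := K) (s := 2) (by omega) hrK hb
    rw [show 4 * K * t + 0 * K + r = 4 * K * t + r by omega] at h1
    rw [h1, h2]
    simp [blkW]
  · have h1 := word_getElem? (K := K) (s := 1) (r := r - K) (by omega) (by omega) hb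
    have h2 := word_getElem? (K := K) (s := 3) (r := r - K) (by omega) (by omega) hb
    rw [show 4 * K * t + 1 * K + (r - K) = 4 * K * t + r by omega] at h1
    rw [show 4 * K * t + 3 * K + (r - K) = 4 * K * t + 2 * K + r by omega] at h2
    rw [h1, h2]
    simp [blkW]

theorem cast_succ_inj {N a b : ℕ} (ha : a < N) (hb : b < N)
    (h : ((a + 1 : ℕ) : ZMod N) = ((b + 1 : ℕ) : ZMod N)) : a = b := by
  rw [ZMod.natCast_eq_natCast_iff] at h
  have h := Nat.ModEq.add_right_cancel' 1 h
  exact Nat.ModEq.eq_of_lt_of_lt h ha hb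

theorem exists_cast_succ {N : ℕ} (hN : 0 < N) (z : ZMod N) :
    ∃ a, a < N ∧ z = ((a + 1 : ℕ) : ZMod N) := by
  have : NeZero N := ⟨by omega⟩
  refine ⟨(z - 1).val, ZMod.val_lt _, ?_⟩
  rw [Nat.cast_add, ZMod.natCast_zmod_val]
  simp

/-- The word graph is a subgraph of the mixed grid. -/
theorem mg_le_mixedGrid {n K : ℕ} (hn : 1 ≤ n) (hK : 1 ≤ K) {Ih Ic : Finset ℕ}
    {l : List (Option Bool)} (hl : l.length = n)
    (hH : ∀ t, l[t]? = some (some true) → t + 1 ∈ Ih)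
    (hC : ∀ t, l[t]? = some (some false) → t + 1 ∈ Ic) :
    IsMinorOf (mg K l) (mixedGrid K n Ih Ic) := by
  have hlen : (expand K (wordOf 0 l)).length = 4 * n * K := by rw [length_word, hl]
  have hf : Function.Injective (fun p : Fin K × Fin (expand K (wordOf 0 l)).length =>
      ((p.1, ((p.2.1 + 1 : ℕ) : ZMod (4 * n * K))) : Fin K × ZMod (4 * n * K))) := by
    rintro ⟨a, b⟩ ⟨c, d⟩ h
    simp only [Prod.mk.injEq] at h ⊢
    exact ⟨h.1, Fin.ext (cast_succ_inj (hlen ▸ b.2) (hlen ▸ d.2) h.2)⟩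
  refine IsMinorOf.of_hom _ hf ?_
  have key : ∀ u v : Fin K × Fin (expand K (wordOf 0 l)).length, u ≠ v →
      cgRel K _ (fun i j => (expand K (wordOf 0 l))[i]? = (expand K (wordOf 0 l))[j]?) u v →
      (mixedGrid K n Ih Ic).Adj (u.1, ((u.2.1 + 1 : ℕ) : ZMod (4 * n * K)))
        (v.1, ((v.2.1 + 1 : ℕ) : ZMod (4 * n * K))) := by
    intro u v huv h
    unfold mixedGrid
    rw [SimpleGraph.fromRel_adj]
    refine ⟨fun h => huv (hf h), ?_⟩
    have hu : u.2.1 < 4 * n * K := lt_of_lt_of_eq u.2.2 hlen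
    have hv : v.2.1 < 4 * n * K := lt_of_lt_of_eq v.2.2 hlen
    rcases h with ⟨h1, h2 | ⟨h2, h3⟩⟩ | ⟨h1, h2⟩ | ⟨h1, h2, h3⟩
    · left; left
      exact ⟨Fin.ext h1, by simp only [h2]; push_cast; ring⟩
    · left; left
      refine ⟨Fin.ext h1, ?_⟩
      simp only [h2, h3, hlen]
      rw [ZMod.natCast_self]
      simp
    · left; right; left
      exact ⟨by simp only [h1], h2⟩
    · have hne : u.2.1 ≠ v.2.1 := by
        intro h
        apply huv
        ext
        · omega
        · exact h
      obtain ⟨t, ht, ⟨hb, r, hr, h⟩ | ⟨hb, r, hr, h⟩⟩ := word_chords hl hu hv hne h3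
      · have hm := hH t hb
        rcases h with ⟨e1, e2⟩ | ⟨e1, e2⟩ | ⟨e1, e2⟩ | ⟨e1, e2⟩
        · left; right; right; left
          refine ⟨h1, h2, t + 1, hm, r + 1, by rw [Finset.mem_Icc]; omega, Or.inl ⟨?_, ?_⟩⟩
          · refine congrArg (Nat.cast : ℕ → ZMod (4 * n * K)) ?_
            rw [Nat.add_sub_cancel]
            omega
          · refine congrArg (Nat.cast : ℕ → ZMod (4 * n * K)) ?_
            rw [Nat.add_sub_cancel]
            omega
        · left; right; right; left
          refine ⟨h1, h2, t + 1, hm, r + 1, by rw [Finset.mem_Icc]; omega, Or.inr ⟨?_, ?_⟩⟩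
          · refine congrArg (Nat.cast : ℕ → ZMod (4 * n * K)) ?_
            rw [Nat.add_sub_cancel]
            omega
          · refine congrArg (Nat.cast : ℕ → ZMod (4 * n * K)) ?_
            rw [Nat.add_sub_cancel]
            omega
        · right; right; right; left
          refine ⟨h2, h1, t + 1, hm, r + 1, by rw [Finset.mem_Icc]; omega, Or.inl ⟨?_, ?_⟩⟩
          · refine congrArg (Nat.cast : ℕ → ZMod (4 * n * K)) ?_
            rw [Nat.add_sub_cancel]
            omega
          · refine congrArg (Nat.cast : ℕ → ZMod (4 * n * K)) ?_
            rw [Nat.add_sub_cancel]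
            omega
        · right; right; right; left
          refine ⟨h2, h1, t + 1, hm, r + 1, by rw [Finset.mem_Icc]; omega, Or.inr ⟨?_, ?_⟩⟩
          · refine congrArg (Nat.cast : ℕ → ZMod (4 * n * K)) ?_
            rw [Nat.add_sub_cancel]
            omega
          · refine congrArg (Nat.cast : ℕ → ZMod (4 * n * K)) ?_
            rw [Nat.add_sub_cancel]
            omega
      · have hm := hC t hb
        rcases h with ⟨e1, e2⟩ | ⟨e1, e2⟩
        · left; right; right; right
          refine ⟨h1, h2, t + 1, hm, r + 1, by rw [Finset.mem_Icc]; omega, ?_, ?_⟩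
          · refine congrArg (Nat.cast : ℕ → ZMod (4 * n * K)) ?_
            rw [Nat.add_sub_cancel]
            omega
          · refine congrArg (Nat.cast : ℕ → ZMod (4 * n * K)) ?_
            rw [Nat.add_sub_cancel]
            omega
        · right; right; right; right
          refine ⟨h2, h1, t + 1, hm, r + 1, by rw [Finset.mem_Icc]; omega, ?_, ?_⟩
          · refine congrArg (Nat.cast : ℕ → ZMod (4 * n * K)) ?_
            rw [Nat.add_sub_cancel]
            omega
          · refine congrArg (Nat.cast : ℕ → ZMod (4 * n * K)) ?_
            rw [Nat.add_sub_cancel]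
            omega
  intro u v huv
  unfold mg lg cg at huv
  rw [SimpleGraph.fromRel_adj] at huv
  rcases huv.2 with h | h
  · exact key u v huv.1 h
  · exact (key v u huv.1.symm h).symm

/-- The mixed grid is a subgraph of the word graph. -/
theorem mixedGrid_le_mg {n K : ℕ} (hn : 1 ≤ n) (hK : 1 ≤ K) {Ih Ic : Finset ℕ}
    {l : List (Option Bool)} (hl : l.length = n)
    (hH : ∀ i ∈ Ih, l[i - 1]? = some (some true))
    (hC : ∀ i ∈ Ic, l[i - 1]? = some (some false)) :
    IsMinorOf (mixedGrid K n Ih Ic) (mg K l) := by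
  have hlen : (expand K (wordOf 0 l)).length = 4 * n * K := by rw [length_word, hl]
  have hN : 0 < 4 * n * K := by positivity
  choose c hc1 hc2 using (exists_cast_succ (N := 4 * n * K) hN)
  have hcc : ∀ a, a < 4 * n * K → c ((a + 1 : ℕ) : ZMod (4 * n * K)) = a := by
    intro a ha
    exact (cast_succ_inj ha (hc1 _) (hc2 _)).symm
  have hf : Function.Injective (fun p : Fin K × ZMod (4 * n * K) =>
      ((p.1, ⟨c p.2, by rw [hlen]; exact hc1 _⟩) :
        Fin K × Fin (expand K (wordOf 0 l)).length)) := by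
    rintro ⟨a, b⟩ ⟨d, e⟩ h
    simp only [Prod.mk.injEq, Fin.mk.injEq] at h ⊢
    exact ⟨h.1, by rw [hc2 b, hc2 e, h.2]⟩
  refine IsMinorOf.of_hom _ hf ?_
  have tlt : ∀ t b, l[t]? = some b → ∀ x, x < 4 * K → 4 * K * t + x < 4 * n * K := by
    intro t b h x hx
    have : t < n := by
      rw [← hl]
      by_contra hcon
      rw [List.getElem?_eq_none (by omega)] at h
      exact absurd h (by simp)
    calc 4 * K * t + x < 4 * K * t + 4 * K := by omega
      _ = 4 * K * (t + 1) := by ring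
      _ ≤ 4 * K * n := Nat.mul_le_mul_left _ this
      _ = 4 * n * K := by ring
  have key : ∀ u v : Fin K × ZMod (4 * n * K),
      ((u.1 = v.1 ∧ v.2 = u.2 + 1) ∨
    (u.2 = v.2 ∧ (v.1 : ℕ) = (u.1 : ℕ) + 1) ∨
    ((u.1 : ℕ) = 0 ∧ (v.1 : ℕ) = 0 ∧ ∃ i ∈ Ih, ∃ j ∈ Finset.Icc 1 K,
      ((u.2 = ((4 * K * (i - 1) + j : ℕ) : ZMod (4 * n * K)) ∧
        v.2 = ((4 * K * (i - 1) + 3 * K - j + 1 : ℕ) : ZMod (4 * n * K))) ∨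
       (u.2 = ((4 * K * (i - 1) + K + j : ℕ) : ZMod (4 * n * K)) ∧
        v.2 = ((4 * K * (i - 1) + 4 * K - j + 1 : ℕ) : ZMod (4 * n * K))))) ∨
    ((u.1 : ℕ) = 0 ∧ (v.1 : ℕ) = 0 ∧ ∃ i ∈ Ic, ∃ j ∈ Finset.Icc 1 (2 * K),
      u.2 = ((4 * K * (i - 1) + j : ℕ) : ZMod (4 * n * K)) ∧
      v.2 = ((4 * K * (i - 1) + 2 * K + j : ℕ) : ZMod (4 * n * K)))) →
      cgRel K (expand K (wordOf 0 l)).length (fun i j => (expand K (wordOf 0 l))[i]? = (expand K (wordOf 0 l))[j]?)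
        (u.1, ⟨c u.2, by rw [hlen]; exact hc1 _⟩) (v.1, ⟨c v.2, by rw [hlen]; exact hc1 _⟩) := by
    intro u v h
    rcases h with ⟨h1, h2⟩ | ⟨h1, h2⟩ | ⟨h1, h2, i, hi, j, hj, ⟨e1, e2⟩ | ⟨e1, e2⟩⟩ |
      ⟨h1, h2, i, hi, j, hj, e1, e2⟩
    · left
      refine ⟨congrArg Fin.val h1, ?_⟩
      simp only [hlen]
      have hcu := hc1 u.2
      by_cases hlast : c u.2 + 1 = 4 * n * K
      · right
        refine ⟨hlast, ?_⟩
        have e : v.2 = ((0 + 1 : ℕ) : ZMod (4 * n * K)) := by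
          rw [h2, hc2 u.2, hlast, ZMod.natCast_self]
          simp
        rw [e]
        exact hcc 0 hN
      · left
        have e : v.2 = ((c u.2 + 1 + 1 : ℕ) : ZMod (4 * n * K)) := by
          rw [h2]
          conv_lhs => rw [hc2 u.2]
          push_cast
          ring
        rw [e]
        exact hcc _ (by omega)
    · right; left
      exact ⟨by simp only [h1], h2⟩
    · right; right
      rw [Finset.mem_Icc] at hj
      have hb := hH i hi
      have hlt := tlt _ _ hb
      refine ⟨h1, h2, ?_⟩
      simp only [e1, e2]
      rw [show 4 * K * (i - 1) + j = (4 * K * (i - 1) + (j - 1)) + 1 by omega,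
        show 4 * K * (i - 1) + 3 * K - j + 1 = (4 * K * (i - 1) + (3 * K - j)) + 1 by omega,
        hcc _ (hlt _ (by omega)), hcc _ (hlt _ (by omega)),
        word_handle_one hb (r := j - 1) (by omega)]
      congr 1
      omega
    · right; right
      rw [Finset.mem_Icc] at hj
      have hb := hH i hi
      have hlt := tlt _ _ hb
      refine ⟨h1, h2, ?_⟩
      simp only [e1, e2]
      rw [show 4 * K * (i - 1) + K + j = (4 * K * (i - 1) + (K + (j - 1))) + 1 by omega,
        show 4 * K * (i - 1) + 4 * K - j + 1 = (4 * K * (i - 1) + (4 * K - j)) + 1 by omega,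
        hcc _ (hlt _ (by omega)), hcc _ (hlt _ (by omega)), ← Nat.add_assoc,
        word_handle_two hb (r := j - 1) (by omega)]
      congr 1
      omega
    · right; right
      rw [Finset.mem_Icc] at hj
      have hb := hC i hi
      have hlt := tlt _ _ hb
      refine ⟨h1, h2, ?_⟩
      simp only [e1, e2]
      rw [show 4 * K * (i - 1) + 2 * K + j = (4 * K * (i - 1) + (2 * K + (j - 1))) + 1 by omega,
        show 4 * K * (i - 1) + j = (4 * K * (i - 1) + (j - 1)) + 1 by omega,
        hcc _ (hlt _ (by omega)), hcc _ (hlt _ (by omega)), ← Nat.add_assoc,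
        word_crosscap hb (r := j - 1) (by omega)]
  intro u v huv
  unfold mixedGrid at huv
  rw [SimpleGraph.fromRel_adj] at huv
  unfold mg lg cg
  rw [SimpleGraph.fromRel_adj]
  refine ⟨fun h => huv.1 (hf h), ?_⟩
  rcases huv.2 with h | h
  · exact Or.inl (key u v h)
  · exact Or.inr (key v u h)

/-- The list of blocks described by a set of handle positions. -/
def blocks (n : ℕ) (Ih : Finset ℕ) : List Bool :=
  (List.range n).map (fun i => decide (i + 2 ∈ Ih))

theorem count_blocks_true (n : ℕ) (Ih : Finset ℕ) (hsub : Ih ⊆ Finset.Icc 2 (n + 1)) :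
    (blocks n Ih).count true = Ih.card := by
  have h1 : (blocks n Ih).count true = ((Finset.range n).filter (fun i => i + 2 ∈ Ih)).card := by
    clear hsub
    unfold blocks
    induction n with
    | zero => simp
    | succ n ih =>
      rw [List.range_succ, List.map_append, List.count_append, ih, Finset.range_add_one,
        Finset.filter_insert]
      by_cases h : n + 2 ∈ Ih
      · rw [if_pos h, Finset.card_insert_of_notMem (by simp)]
        simp [h]
      · simp [h]
  rw [h1]
  refine Finset.card_bij (fun i _ => i + 2) ?_ ?_ ?_
  · intro a ha
    exact (Finset.mem_filter.mp ha).2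
  · intro a _ b _ h
    omega
  · intro b hb
    have := Finset.mem_Icc.mp (hsub hb)
    refine ⟨b - 2, ?_, by omega⟩
    rw [Finset.mem_filter, Finset.mem_range, show b - 2 + 2 = b by omega]
    exact ⟨by omega, hb⟩

theorem count_blocks_false (n : ℕ) (Ih : Finset ℕ) :
    (blocks n Ih).count true + (blocks n Ih).count false = n := by
  have h : ∀ l : List Bool, l.count true + l.count false = l.length := by
    intro l
    induction l with
    | nil => rfl
    | cons a l ih => cases a <;> simp <;> omega
  rw [h]
  simp [blocks]

theorem blocks_getElem? (n t : ℕ) (Ih : Finset ℕ) (b : Bool) :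
    (none :: (blocks n Ih).map some)[t]? = some (some b) ↔
      1 ≤ t ∧ t ≤ n ∧ decide (t + 1 ∈ Ih) = b := by
  cases t with
  | zero => simp
  | succ t =>
    rw [List.getElem?_cons_succ, blocks]
    by_cases h : t < n
    · simp [h]
    · rw [List.getElem?_eq_none (by simp; omega)]
      simp
      omega

end Endpoints

/-- Let `g > 0` and `h, c, h', c' ≥ 0` with `c > 0`, `c' > 0` and
`2h + c = 2h' + c' = g`.  Then for every `k ≥ 1`, every partition `{I_hdl, I_crscp}` of
`[2, h+c+1]` with `|I_hdl| = h`, `|I_crscp| = c`, and every partition `{I'_hdl, I'_crscp}`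
of `[2, h'+c'+1]` with `|I'_hdl| = h'`, `|I'_crscp| = c'`, the mixed surface grid of order
`162^(4g)·k` with `h` handles and `c` crosscaps contains the mixed surface grid of order `k`
with `h'` handles and `c'` crosscaps as a minor. -/
theorem mixedGrid_same_genus_minor (g h c h' c' k : ℕ)
    (hg0 : 0 < g) (hc : 0 < c) (hc' : 0 < c')
    (hghc : 2 * h + c = g) (hghc' : 2 * h' + c' = g)
    (hk : 1 ≤ k)
    (Ih Ic : Finset ℕ)
    (hpart : Ih ∪ Ic = Finset.Icc 2 (h + c + 1)) (hdisj : Disjoint Ih Ic)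
    (hIh : Ih.card = h) (hIc : Ic.card = c)
    (I'h I'c : Finset ℕ)
    (hpart' : I'h ∪ I'c = Finset.Icc 2 (h' + c' + 1)) (hdisj' : Disjoint I'h I'c)
    (hI'h : I'h.card = h') (hI'c : I'c.card = c') :
    IsMinorOf (mixedGrid k (h' + c' + 1) I'h I'c)
      (mixedGrid (162 ^ (4 * g) * k) (h + c + 1) Ih Ic) := by
  have hshape : ∀ (h c : ℕ) (Ih Ic : Finset ℕ), Ih ∪ Ic = Finset.Icc 2 (h + c + 1) →
      Disjoint Ih Ic → Ih.card = h →
      (blocks (h + c) Ih).count true = h ∧ (blocks (h + c) Ih).count false = c := by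
    intro h c Ih Ic hp hd hh
    have h1 := count_blocks_true (h + c) Ih (by rw [← hp]; exact Finset.subset_union_left)
    have h2 := count_blocks_false (h + c) Ih
    omega
  obtain ⟨a1, a2⟩ := hshape h c Ih Ic hpart hdisj hIh
  obtain ⟨b1, b2⟩ := hshape h' c' I'h I'c hpart' hdisj' hI'h
  have hpow1 : 1 ≤ 32 ^ h' := Nat.one_le_pow _ _ (by norm_num)
  have hpow2 : 1 ≤ 32 ^ h := Nat.one_le_pow _ _ (by norm_num)
  have hk1 : 1 ≤ 32 ^ h' * k := Nat.mul_pos hpow1 hk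
  have hk2 : 1 ≤ 32 ^ h * (32 ^ h' * k) := Nat.mul_pos hpow2 hk1
  have hle : 32 ^ h * (32 ^ h' * k) ≤ 162 ^ (4 * g) * k := by
    rw [← Nat.mul_assoc, ← pow_add]
    apply Nat.mul_le_mul_right
    calc 32 ^ (h + h') ≤ 162 ^ (h + h') := Nat.pow_le_pow_left (by norm_num) _
      _ ≤ 162 ^ (4 * g) := Nat.pow_le_pow_right (by norm_num) (by omega)
  have n1 := (mg_norm h (blocks (h + c) Ih) a1 (List.count_pos_iff.mp (by omega))
    (32 ^ h' * k) hk1).1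
  have n2 := (mg_norm h' (blocks (h' + c') I'h) b1 (List.count_pos_iff.mp (by omega)) k hk).2
  rw [a2, hghc] at n1
  rw [b2, hghc'] at n2
  have e1 : IsMinorOf (mg (162 ^ (4 * g) * k) (none :: (blocks (h + c) Ih).map some))
      (mixedGrid (162 ^ (4 * g) * k) (h + c + 1) Ih Ic) := by
    refine mg_le_mixedGrid (by omega) (hk2.trans hle) (by simp [blocks]) ?_ ?_
    · intro t ht
      rw [blocks_getElem?] at ht
      exact of_decide_eq_true ht.2.2
    · intro t ht
      rw [blocks_getElem?] at ht
      have hm : t + 1 ∈ Ih ∪ Ic := by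
        rw [hpart, Finset.mem_Icc]
        omega
      exact (Finset.mem_union.mp hm).resolve_left (of_decide_eq_false ht.2.2)
  have e2 : IsMinorOf (mixedGrid k (h' + c' + 1) I'h I'c)
      (mg k (none :: (blocks (h' + c') I'h).map some)) := by
    refine mixedGrid_le_mg (by omega) hk (by simp [blocks]) ?_ ?_
    · intro i hi
      have hm : i ∈ I'h ∪ I'c := Finset.mem_union_left _ hi
      rw [hpart', Finset.mem_Icc] at hm
      rw [blocks_getElem?, show i - 1 + 1 = i by omega]
      exact ⟨by omega, by omega, decide_eq_true hi⟩
    · intro i hi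
      have hm : i ∈ I'h ∪ I'c := Finset.mem_union_right _ hi
      rw [hpart', Finset.mem_Icc] at hm
      rw [blocks_getElem?, show i - 1 + 1 = i by omega]
      exact ⟨by omega, by omega, decide_eq_false (fun h => Finset.disjoint_left.mp hdisj' h hi)⟩
  exact e2.trans (n2.trans (n1.trans ((mg_mono hk2 hle (by simp)).trans e1)))
end

section
/- Let k ≥ 2 be an integer, let G be a graph, and let {X_v}_{v ∈ V(Γ_k)} be a minor model of the (k × k)-grid Γ_k in G. Let Q be a row (or a column) of Γ_k, and let S ⊆ V(G) be a set obtained by selecting exactly one vertex s_v ∈ X_v for each v ∈ V(Q). Then S is strongly linked in G. -/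
open SimpleGraph

/-- `(A, B)` is a separation of the graph `G`: `A ∪ B = V(G)` and there is no edge of `G`
with one endpoint in `A \ B` and the other in `B \ A`.  Its order is `(A ∩ B).ncard`. -/
def IsSep {V : Type*} (G : SimpleGraph V) (A B : Set V) : Prop :=
  A ∪ B = Set.univ ∧ ∀ a b : V, a ∈ A \ B → b ∈ B \ A → ¬ G.Adj a b

/-- `X` is an `α`-balanced separator for `S` in `G`: every connected component `C` of
`G − X` satisfies `|V(C) ∩ S| ≤ α·|S|`. -/
def BalancedSeparator {V : Type*} (G : SimpleGraph V) (α : ℝ) (S X : Set V) : Prop :=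
  ∀ C : (G.induce Xᶜ).ConnectedComponent,
    (((Subtype.val '' C.supp) ∩ S).ncard : ℝ) ≤ α * (S.ncard : ℝ)

/-- `S` is `(q, α)`-well-linked in `G`: there is no `α`-balanced separator for `S` of size
at most `q`. -/
def WellLinked {V : Type*} (G : SimpleGraph V) (q : ℕ) (α : ℝ) (S : Set V) : Prop :=
  ∀ X : Set V, X.ncard ≤ q → ¬ BalancedSeparator G α S X

/-- `F` is `S`-free in `G` (with respect to the constant `α`): for every separation
`(A₁, A₂)` of `G` of order less than `|F|` and every side containing `F`, that side
contains more than `α·|S|` vertices of `S`. -/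
def SFree {V : Type*} (G : SimpleGraph V) (α : ℝ) (S F : Set V) : Prop :=
  ∀ A₁ A₂ : Set V, IsSep G A₁ A₂ → (A₁ ∩ A₂).ncard < F.ncard →
    (F ⊆ A₁ → α * (S.ncard : ℝ) < ((A₁ ∩ S).ncard : ℝ)) ∧
    (F ⊆ A₂ → α * (S.ncard : ℝ) < ((A₂ ∩ S).ncard : ℝ))

/-- `S` is strongly linked in `G`: for every partition `{S₁, S₂}` of `S` into two nonempty
parts, there is no separation `(A₁, A₂)` of `G` with `S₁ ⊆ A₁`, `S₂ ⊆ A₂` and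
`|A₁ ∩ A₂| < min {|S₁|, |S₂|}`. -/
def StronglyLinked {V : Type*} (G : SimpleGraph V) (S : Set V) : Prop :=
  ∀ S₁ S₂ A₁ A₂ : Set V, S₁ ∪ S₂ = S → Disjoint S₁ S₂ → S₁.Nonempty → S₂.Nonempty →
    IsSep G A₁ A₂ → S₁ ⊆ A₁ → S₂ ⊆ A₂ →
    min S₁.ncard S₂.ncard ≤ (A₁ ∩ A₂).ncard

/-- `G[A₁] ∪ G[A₂] ∪ G[A₃] = G`: the three induced subgraphs jointly cover all vertices and
all edges of `G`. -/
def TriCover {V : Type*} (G : SimpleGraph V) (A₁ A₂ A₃ : Set V) : Prop :=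
  A₁ ∪ A₂ ∪ A₃ = Set.univ ∧
  ∀ u v : V, G.Adj u v →
    (u ∈ A₁ ∧ v ∈ A₁) ∨ (u ∈ A₂ ∧ v ∈ A₂) ∨ (u ∈ A₃ ∧ v ∈ A₃)

/-- `T` is a tangle of order `k` in `G`: `T` consists of separations of order less than `k`,
orients every such separation (contains exactly one of `(A,B)` and `(B,A)`), and no three
small sides of members of `T` cover `G`. -/
def IsTangle {V : Type*} (G : SimpleGraph V) (k : ℕ) (T : Set (Set V × Set V)) : Prop :=
  (∀ p ∈ T, IsSep G p.1 p.2 ∧ (p.1 ∩ p.2).ncard < k) ∧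
  (∀ A B : Set V, IsSep G A B → (A ∩ B).ncard < k → ((A, B) ∈ T ↔ (B, A) ∉ T)) ∧
  (∀ p₁ ∈ T, ∀ p₂ ∈ T, ∀ p₃ ∈ T, ¬ TriCover G p₁.1 p₂.1 p₃.1)

/-- The `(k × k)`-grid `Γ_k`: vertex set `[k] × [k]`, with `(i,j)` adjacent to `(i,j+1)` and
to `(i+1,j)`. -/
def gridGraph (p q : ℕ) : SimpleGraph (Fin p × Fin q) :=
  SimpleGraph.fromRel (fun a b =>
    (a.1 = b.1 ∧ (b.2 : ℕ) = (a.2 : ℕ) + 1) ∨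
    (a.2 = b.2 ∧ (b.1 : ℕ) = (a.1 : ℕ) + 1))

theorem aux_conn {V : Type*} (G : SimpleGraph V) (A B Y : Set V) (hsep : IsSep G A B)
    (hc : (G.induce Y).Connected) (hZ : Disjoint Y (A ∩ B)) (a : V) (ha : a ∈ Y) (haA : a ∈ A) :
    Y ⊆ A := by
  intro b hb
  obtain ⟨p⟩ := hc.preconnected ⟨a, ha⟩ ⟨b, hb⟩
  have key : ∀ (u v : Y), (G.induce Y).Walk u v → u.1 ∈ A → v.1 ∈ A := by
    intro u v p
    induction p with
    | nil => exact id
    | @cons u v w h p ih =>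
      intro hu
      apply ih
      by_contra hv
      have hvB : v.1 ∈ B := by
        have : v.1 ∈ A ∪ B := by rw [hsep.1]; trivial
        exact this.resolve_left hv
      have huB : u.1 ∉ B := fun h => Set.disjoint_left.1 hZ u.2 ⟨hu, h⟩
      exact hsep.2 _ _ ⟨hu, huB⟩ ⟨hvB, hv⟩ h
  exact key _ _ p haA

theorem aux_step {V : Type*} (G : SimpleGraph V) (A B Y W : Set V) (hsep : IsSep G A B)
    (hcW : (G.induce W).Connected)
    (hY : Disjoint Y (A ∩ B)) (hW : Disjoint W (A ∩ B))
    (h : ∃ a ∈ Y, ∃ b ∈ W, G.Adj a b) (hA : Y ⊆ A) : W ⊆ A := by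
  obtain ⟨a, ha, b, hb, hab⟩ := h
  refine aux_conn G A B W hsep hcW hW b hb ?_
  by_contra hv
  have hvB : b ∈ B := by
    have : b ∈ A ∪ B := by rw [hsep.1]; trivial
    exact this.resolve_left hv
  exact hsep.2 _ _ ⟨hA ha, fun h => Set.disjoint_left.1 hY ha ⟨hA ha, h⟩⟩ ⟨hvB, hv⟩ hab

theorem aux_line {V : Type*} (G : SimpleGraph V) (A B : Set V) (hsep : IsSep G A B) (k : ℕ)
    (f : Fin k → Set V) (hc : ∀ i, (G.induce (f i)).Connected)
    (hZ : ∀ i, Disjoint (f i) (A ∩ B))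
    (hadj : ∀ i j : Fin k, (j : ℕ) = i + 1 → ∃ a ∈ f i, ∃ b ∈ f j, G.Adj a b)
    (i j : Fin k) (hi : f i ⊆ A) : f j ⊆ A := by
  have key : ∀ n (hn : n < k), f ⟨n, hn⟩ ⊆ A ↔ f ⟨0, by omega⟩ ⊆ A := by
    intro n
    induction n with
    | zero => intro hn; rfl
    | succ n ih =>
      intro hn
      rw [← ih (by omega)]
      have h := hadj ⟨n, by omega⟩ ⟨n + 1, hn⟩ rfl
      constructor
      · refine aux_step G A B _ _ hsep (hc _) (hZ _) (hZ _) ?_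
        obtain ⟨a, ha, b, hb, hab⟩ := h
        exact ⟨b, hb, a, ha, hab.symm⟩
      · exact aux_step G A B _ _ hsep (hc _) (hZ _) (hZ _) h
  exact (key j j.2).2 ((key i i.2).1 hi)

theorem aux_pigeon {V : Type*} [Fintype V] {k : ℕ} (Z : Set V) (J : Set (Fin k))
    (X : Fin k → Fin k → Set V)
    (hd : ∀ i i' j j', i ≠ i' → Disjoint (X i j) (X i' j'))
    (h : Z.ncard < J.ncard) : ∃ i ∈ J, ∀ j, Disjoint (X i j) Z := by
  by_contra! hcon
  have : ∀ i : Fin k, ∃ z, i ∈ J → z ∈ Z ∧ ∃ j, z ∈ X i j := by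
    intro i
    by_cases hi : i ∈ J
    · obtain ⟨j, hj⟩ := hcon i hi
      obtain ⟨z, hz1, hz2⟩ := Set.not_disjoint_iff.1 hj
      exact ⟨z, fun _ => ⟨hz2, j, hz1⟩⟩
    · have : Nonempty V := by
        by_contra hV
        rw [not_nonempty_iff] at hV
        obtain ⟨a, ha⟩ : J.Nonempty := by
          rw [← Set.ncard_pos]; omega
        obtain ⟨j, hj⟩ := hcon a ha
        obtain ⟨z, -, -⟩ := Set.not_disjoint_iff.1 hj
        exact hV.elim z
      exact ⟨this.some, fun h => absurd h hi⟩
  choose z hz using this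
  have := Set.ncard_le_ncard_of_injOn (s := J) (t := Z) z (fun i hi => (hz i hi).1) (by
    intro a ha b hb hab
    by_contra hne
    obtain ⟨-, j, hj⟩ := hz a ha
    obtain ⟨-, j', hj'⟩ := hz b hb
    rw [hab] at hj
    exact Set.disjoint_left.1 (hd a b j j' hne) hj hj') (Set.toFinite _)
  omega

theorem aux_main {V : Type*} [Fintype V] (G : SimpleGraph V) (k : ℕ)
    (X : Fin k → Fin k → Set V)
    (hdisj : ∀ i j i' j', (i ≠ i' ∨ j ≠ j') → Disjoint (X i j) (X i' j'))
    (hconn : ∀ i j, (G.induce (X i j)).Connected)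
    (hrow : ∀ i j j' : Fin k, (j' : ℕ) = j + 1 → ∃ a ∈ X i j, ∃ b ∈ X i j', G.Adj a b)
    (hcol : ∀ i i' j : Fin k, (i' : ℕ) = i + 1 → ∃ a ∈ X i j, ∃ b ∈ X i' j, G.Adj a b)
    (i₀ : Fin k) (s : Fin k → V) (hs : ∀ j, s j ∈ X i₀ j) :
    StronglyLinked G (Set.range s) := by
  intro S₁ S₂ A B hS _ _ _ hsep h1 h2
  by_contra! hlt
  have hpre : ∀ T : Set V, T ⊆ Set.range s → T.ncard ≤ (s ⁻¹' T).ncard := by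
    intro T hT
    calc T.ncard = (s '' (s ⁻¹' T)).ncard := by rw [Set.image_preimage_eq_of_subset hT]
      _ ≤ _ := Set.ncard_image_le (Set.toFinite _)
  have c1 := hpre S₁ (hS ▸ Set.subset_union_left)
  have c2 := hpre S₂ (hS ▸ Set.subset_union_right)
  have hl := lt_min_iff.1 hlt
  have hcd : ∀ i i' j j' : Fin k, i ≠ i' → Disjoint (X j i) (X j' i') :=
    fun i i' j j' h => hdisj _ _ _ _ (Or.inr h)
  obtain ⟨j1, hj1, d1⟩ := aux_pigeon (A ∩ B) (s ⁻¹' S₁) (fun j i => X i j) hcd (by omega)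
  obtain ⟨j2, hj2, d2⟩ := aux_pigeon (A ∩ B) (s ⁻¹' S₂) (fun j i => X i j) hcd (by omega)
  obtain ⟨r, -, dr⟩ := aux_pigeon (A ∩ B) Set.univ X
    (fun i i' j j' h => hdisj _ _ _ _ (Or.inl h))
    (lt_of_lt_of_le (lt_of_lt_of_le hl.1 c1)
      (Set.ncard_le_ncard (Set.subset_univ _) (Set.toFinite _)))
  have e1 : X i₀ j1 ⊆ A :=
    aux_conn G A B _ hsep (hconn _ _) (d1 i₀) (s j1) (hs j1) (h1 hj1)
  have e2 : X r j1 ⊆ A :=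
    aux_line G A B hsep k (fun i => X i j1) (fun i => hconn i j1) d1
      (fun i i' h => hcol i i' j1 h) i₀ r e1
  have e3 : X r j2 ⊆ A :=
    aux_line G A B hsep k (fun j => X r j) (fun j => hconn r j) dr (hrow r) j1 j2 e2
  have e4 : X i₀ j2 ⊆ A :=
    aux_line G A B hsep k (fun i => X i j2) (fun i => hconn i j2) d2
      (fun i i' h => hcol i i' j2 h) r i₀ e3
  exact Set.disjoint_left.1 (d2 i₀) (hs j2) ⟨e4 (hs j2), h2 hj2⟩

/-- Let `k ≥ 2`, let `G` be a finite graph, and let `{X_v}` be a minor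
model of the `(k × k)`-grid `Γ_k` in `G`.  Let `Q` be a row or a column of `Γ_k`, and let
`S` be obtained by selecting exactly one vertex `s_v ∈ X_v` for each `v ∈ V(Q)`.  Then `S`
is strongly linked in `G`. -/
theorem gridModel_row_stronglyLinked {V : Type*} [Fintype V] (G : SimpleGraph V) (k : ℕ)
    (hk : 2 ≤ k) (X : Fin k × Fin k → Set V)
    (hdisj : ∀ u v : Fin k × Fin k, u ≠ v → Disjoint (X u) (X v))
    (hconn : ∀ v : Fin k × Fin k, (G.induce (X v)).Connected)
    (hadj : ∀ u v : Fin k × Fin k, (gridGraph k k).Adj u v →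
      ∃ a ∈ X u, ∃ b ∈ X v, G.Adj a b)
    (i₀ : Fin k) (s : Fin k → V)
    (hs : (∀ j : Fin k, s j ∈ X (i₀, j)) ∨ (∀ j : Fin k, s j ∈ X (j, i₀))) :
    StronglyLinked G (Set.range s) := by
  have hR : ∀ i j j' : Fin k, (j' : ℕ) = j + 1 →
      ∃ a ∈ X (i, j), ∃ b ∈ X (i, j'), G.Adj a b := by
    intro i j j' h
    refine hadj _ _ ?_
    rw [gridGraph, SimpleGraph.fromRel_adj]
    refine ⟨fun he => ?_, Or.inl (Or.inl ⟨rfl, h⟩)⟩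
    have := congrArg (fun p => (p.2 : ℕ)) he
    simp only at this
    omega
  have hC : ∀ i i' j : Fin k, (i' : ℕ) = i + 1 →
      ∃ a ∈ X (i, j), ∃ b ∈ X (i', j), G.Adj a b := by
    intro i i' j h
    refine hadj _ _ ?_
    rw [gridGraph, SimpleGraph.fromRel_adj]
    refine ⟨fun he => ?_, Or.inl (Or.inr ⟨rfl, h⟩)⟩
    have := congrArg (fun p => (p.1 : ℕ)) he
    simp only at this
    omega
  rcases hs with hs | hs
  · refine aux_main G k (fun i j => X (i, j)) (fun i j i' j' h => hdisj _ _ ?_)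
      (fun i j => hconn _) hR hC i₀ s hs
    intro he
    simp only [Prod.mk.injEq] at he
    tauto
  · refine aux_main G k (fun i j => X (j, i)) (fun i j i' j' h => hdisj _ _ ?_)
      (fun i j => hconn _) (fun i j j' h => hC j j' i h) (fun i i' j h => hR j i i' h) i₀ s hs
    intro he
    simp only [Prod.mk.injEq] at he
    tauto
end
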